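/- Let A₁, …, A_n be nonnegative real numbers, let w(x) = x₁^{A₁} ⋯ x_n^{A_n}, and let Σ = {x ∈ ℝⁿ : x_i > 0 for all i such that A_i > 0}. Set α = A₁ + ⋯ + A_n and D = n + α. Then for every bounded Lipschitz domain Ω ⊂ Σ, one has P_Σ(Ω) / m(Ω)^{(D-1)/D} ≥ P_Σ(Σ ∩ B₁) / m(Σ ∩ B₁)^{(D-1)/D}, where B₁ is the open Euclidean unit ball of ℝⁿ centered at the origin. -/

import Mathlib

open MeasureTheory Metric Set
open scoped RealInnerProductSpace NNReal ENNReal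

noncomputable section

/-- A bounded Lipschitz domain in `ℝⁿ`: a bounded, connected, open set whose boundary is
locally the graph of a Lipschitz function (the set lying locally on one side of the graph). -/
def IsLipschitzDomain {n : ℕ} (Ω : Set (EuclideanSpace ℝ (Fin n))) : Prop :=
  IsOpen Ω ∧ IsConnected Ω ∧ Bornology.IsBounded Ω ∧
  ∀ x ∈ frontier Ω, ∃ r > (0:ℝ), ∃ v : EuclideanSpace ℝ (Fin n), ‖v‖ = 1 ∧
    ∃ (K : ℝ≥0) (φ : EuclideanSpace ℝ (Fin n) → ℝ), LipschitzWith K φ ∧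
      ∀ y ∈ ball x r, (y ∈ Ω ↔ φ (y - ⟪y, v⟫ • v) < ⟪y, v⟫)

theorem IsCompact.volume_add_volume_le {K L C : Set ℝ} (hK : IsCompact K) (hL : IsCompact L)
    (hK' : K.Nonempty) (hL' : L.Nonempty) (h : ∀ a ∈ K, ∀ b ∈ L, a + b ∈ C) :
    volume K + volume L ≤ volume C := by
  obtain ⟨a, ha, hamax⟩ := hK.exists_isGreatest hK'
  obtain ⟨b, hb, hbmin⟩ := hL.exists_isLeast hL'
  have h1 : volume ((fun x => b + x) '' K) = volume K := by
    rw [image_add_left]; exact measure_preimage_add _ _ _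
  have h2 : volume ((fun x => a + x) '' L) = volume L := by
    rw [image_add_left]; exact measure_preimage_add _ _ _
  rw [← h1, ← h2, ← measure_union₀]
  · refine measure_mono (union_subset ?_ ?_)
    · rintro _ ⟨x, hx, rfl⟩
      simpa [add_comm] using h x hx b hb
    · rintro _ ⟨x, hx, rfl⟩
      exact h a ha x hx
  · exact (hL.image (by fun_prop)).measurableSet.nullMeasurableSet
  · refine measure_mono_null (t := {a + b}) ?_ (by simp)
    rintro _ ⟨⟨x, hx, rfl⟩, ⟨y, hy, hxy⟩⟩
    have := hamax hx
    have := hbmin hy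
    simp only [mem_singleton_iff] at *
    linarith

/-- The one-dimensional Brunn–Minkowski inequality. -/
theorem Real.volume_add_volume_le {A B C : Set ℝ} (hA : MeasurableSet A) (hB : MeasurableSet B)
    (hA' : A.Nonempty) (hB' : B.Nonempty) (h : ∀ a ∈ A, ∀ b ∈ B, a + b ∈ C) :
    volume A + volume B ≤ volume C := by
  obtain ⟨a, ha⟩ := hA'
  obtain ⟨b, hb⟩ := hB'
  have key : ∀ K ⊆ A, IsCompact K → ∀ L ⊆ B, IsCompact L → volume K + volume L ≤ volume C := by
    intro K hKA hK L hLB hL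
    refine le_trans (add_le_add (measure_mono (subset_insert a K))
      (measure_mono (subset_insert b L))) ?_
    refine (hK.insert a).volume_add_volume_le (hL.insert b) (insert_nonempty _ _)
      (insert_nonempty _ _) fun x hx y hy => h x ?_ y ?_
    · exact insert_subset ha hKA hx
    · exact insert_subset hb hLB hy
  rw [hA.measure_eq_iSup_isCompact, hB.measure_eq_iSup_isCompact]
  simp only [iSup_and']
  refine ENNReal.biSup_add_biSup_le' ⟨∅, by simp⟩ ⟨∅, by simp⟩ ?_
  exact fun K hK L hL => key K hK.1 hK.2 L hL.1 hL.2

theorem ENNReal.geom_mean_le_arith_mean2_weighted {s t : ℝ} (hs : 0 < s) (ht : 0 < t)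
    (hst : s + t = 1) (a b : ℝ≥0∞) :
    a ^ s * b ^ t ≤ ENNReal.ofReal s * a + ENNReal.ofReal t * b := by
  by_cases ha : a = ∞
  · simp [ha, hs]
  by_cases hb : b = ∞
  · simp [hb, ht]
  lift a to ℝ≥0 using ha
  lift b to ℝ≥0 using hb
  lift s to ℝ≥0 using hs.le
  lift t to ℝ≥0 using ht.le
  rw [← ENNReal.coe_rpow_of_nonneg _ s.coe_nonneg, ← ENNReal.coe_rpow_of_nonneg _ t.coe_nonneg]
  simp only [ENNReal.ofReal_coe_nnreal]
  exact_mod_cast NNReal.geom_mean_le_arith_mean2_weighted s t a b (by exact_mod_cast hst)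

/-- A measure on a real vector space satisfies the Prékopa–Leindler inequality. -/
def PrekopaLeindler {E : Type*} [AddCommGroup E] [Module ℝ E] [MeasurableSpace E]
    (μ : Measure E) : Prop :=
  ∀ ⦃s t : ℝ⦄, 0 < s → 0 < t → s + t = 1 → ∀ ⦃f g h : E → ℝ≥0∞⦄,
    Measurable f → Measurable g → Measurable h →
    (∀ x y, f x ^ s * g y ^ t ≤ h (s • x + t • y)) →
    (∫⁻ x, f x ∂μ) ^ s * (∫⁻ x, g x ∂μ) ^ t ≤ ∫⁻ x, h x ∂μ

theorem lintegral_eq_lintegral_meas_lt_of_le_one {α : Type*} [MeasurableSpace α] (μ : Measure α)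
    {f : α → ℝ≥0∞} (hf : Measurable f) (hf1 : ∀ x, f x ≤ 1) :
    ∫⁻ x, f x ∂μ = ∫⁻ u in Ioo (0 : ℝ) 1, μ {x | ENNReal.ofReal u < f x} := by
  have hfin : ∀ x, f x ≠ ∞ := fun x => ne_top_of_le_ne_top ENNReal.one_ne_top (hf1 x)
  have h1 : ∫⁻ x, f x ∂μ = ∫⁻ x, ENNReal.ofReal (f x).toReal ∂μ := by
    simp [ENNReal.ofReal_toReal (hfin _)]
  rw [h1, lintegral_eq_lintegral_meas_lt μ (by filter_upwards with x; simp)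
    hf.ennreal_toReal.aemeasurable]
  have h2 : ∫⁻ u in Ioi (0 : ℝ), μ {x | u < (f x).toReal}
      = ∫⁻ u in Ioi (0 : ℝ), μ {x | ENNReal.ofReal u < f x} := by
    refine setLIntegral_congr_fun measurableSet_Ioi fun u hu => ?_
    congr 1
    ext x
    exact (ENNReal.ofReal_lt_iff_lt_toReal (le_of_lt hu) (hfin x)).symm
  rw [h2, ← Ioo_union_Ici_eq_Ioi (zero_lt_one' ℝ), lintegral_union measurableSet_Ici]
  · refine (congrArg _ ?_).trans (add_zero _)
    refine setLIntegral_eq_zero measurableSet_Ici fun u hu => ?_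
    have : {x | ENNReal.ofReal u < f x} = ∅ := by
      ext x
      simp only [mem_ofPred_eq, mem_empty_iff_false, iff_false, not_lt]
      exact (hf1 x).trans (by simpa using hu)
    simp [this]
  · exact Set.disjoint_left.2 fun x hx hx' => absurd hx.2 (not_lt.2 hx')

theorem lintegral_add_le_of_forall_rpow_mul_rpow_le {s t : ℝ} (hs : 0 < s) (ht : 0 < t)
    (hst : s + t = 1) {f g h : ℝ → ℝ≥0∞} (hf : Measurable f) (hg : Measurable g)
    (hh : Measurable h) (hfgh : ∀ x y, f x ^ s * g y ^ t ≤ h (s • x + t • y))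
    (hf1 : ⨆ x, f x = 1) (hg1 : ⨆ x, g x = 1) :
    ENNReal.ofReal s * (∫⁻ x, f x) + ENNReal.ofReal t * (∫⁻ x, g x) ≤ ∫⁻ x, h x := by
  have hf1' : ∀ x, f x ≤ 1 := fun x => hf1 ▸ le_iSup f x
  have hg1' : ∀ x, g x ≤ 1 := fun x => hg1 ▸ le_iSup g x
  have h_min : ∫⁻ x, min (h x) 1 ≤ ∫⁻ x, h x := lintegral_mono fun x => min_le_left _ _
  refine le_trans ?_ h_min
  rw [lintegral_eq_lintegral_meas_lt_of_le_one volume hf hf1',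
    lintegral_eq_lintegral_meas_lt_of_le_one volume hg hg1',
    lintegral_eq_lintegral_meas_lt_of_le_one volume (hh.min measurable_const)
      fun x => min_le_right _ _,
    ← lintegral_const_mul' _ _ ENNReal.ofReal_ne_top,
    ← lintegral_const_mul' _ _ ENNReal.ofReal_ne_top]
  rw [← lintegral_add_left']
  swap
  · refine (Measurable.const_mul ?_ _).aemeasurable
    refine Antitone.measurable fun u v huv => measure_mono fun x hx => ?_
    exact lt_of_le_of_lt (ENNReal.ofReal_le_ofReal huv) hx
  refine setLIntegral_mono' measurableSet_Ioo fun u hu => ?_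
  have hscale : ∀ (r : ℝ), 0 < r → ∀ A : Set ℝ,
      ENNReal.ofReal r * volume A = volume ((fun x => r * x) '' A) := by
    intro r hr A
    have := Measure.addHaar_smul (volume : Measure ℝ) r A
    simp only [Module.finrank_self, pow_one, abs_of_pos hr] at this
    rw [← this]; rfl
  have hu1 : ENNReal.ofReal u < 1 := by
    rw [← ENNReal.ofReal_one]; exact ENNReal.ofReal_lt_ofReal_iff_of_nonneg hu.1.le |>.2 hu.2
  rw [hscale s hs, hscale t ht]
  refine Real.volume_add_volume_le ?_ ?_ ?_ ?_ ?_
  · exact (measurableEmbedding_mulLeft₀ hs.ne').measurableSet_image' (hf measurableSet_Ioi)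
  · exact (measurableEmbedding_mulLeft₀ ht.ne').measurableSet_image' (hg measurableSet_Ioi)
  · rw [← hf1] at hu1
    obtain ⟨x, hx⟩ := lt_iSup_iff.1 hu1
    exact ⟨_, mem_image_of_mem _ hx⟩
  · rw [← hg1] at hu1
    obtain ⟨x, hx⟩ := lt_iSup_iff.1 hu1
    exact ⟨_, mem_image_of_mem _ hx⟩
  · rintro _ ⟨x, hx, rfl⟩ _ ⟨y, hy, rfl⟩
    refine lt_min ?_ hu1
    refine lt_of_lt_of_le ?_ (hfgh x y)
    have hu0 : ENNReal.ofReal u ≠ 0 := by simpa using hu.1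
    calc ENNReal.ofReal u = ENNReal.ofReal u ^ s * ENNReal.ofReal u ^ t := by
          rw [← ENNReal.rpow_add _ _ hu0 ENNReal.ofReal_ne_top, hst, ENNReal.rpow_one]
      _ < _ := ENNReal.mul_lt_mul (ENNReal.rpow_lt_rpow hx hs) (ENNReal.rpow_lt_rpow hy ht)

theorem rpow_lintegral_mul_rpow_lintegral_le_of_bounded {s t : ℝ} (hs : 0 < s) (ht : 0 < t)
    (hst : s + t = 1) {f g h : ℝ → ℝ≥0∞} (hf : Measurable f) (hg : Measurable g)
    (hh : Measurable h) (hfgh : ∀ x y, f x ^ s * g y ^ t ≤ h (s • x + t • y))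
    (hfb : ⨆ x, f x ≠ ∞) (hgb : ⨆ x, g x ≠ ∞) :
    (∫⁻ x, f x) ^ s * (∫⁻ x, g x) ^ t ≤ ∫⁻ x, h x := by
  set F := ⨆ x, f x with hF
  set G := ⨆ x, g x with hG
  by_cases hF0 : F = 0
  · have : ∀ x, f x = 0 := fun x => le_antisymm (hF0 ▸ le_iSup f x) bot_le
    simp [this, hs]
  by_cases hG0 : G = 0
  · have : ∀ x, g x = 0 := fun x => le_antisymm (hG0 ▸ le_iSup g x) bot_le
    simp [this, ht]
  set c := F ^ s * G ^ t with hc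
  have hFs0 : F ^ s ≠ 0 := by simp [hF0, hfb]
  have hGt0 : G ^ t ≠ 0 := by simp [hG0, hgb]
  have hFs : F ^ s ≠ ∞ := ENNReal.rpow_ne_top_of_nonneg hs.le hfb
  have hGt : G ^ t ≠ ∞ := ENNReal.rpow_ne_top_of_nonneg ht.le hgb
  have hc0 : c ≠ 0 := mul_ne_zero hFs0 hGt0
  have hct : c ≠ ∞ := ENNReal.mul_ne_top hFs hGt
  have key : ∀ a b : ℝ≥0∞, (F⁻¹ * a) ^ s * (G⁻¹ * b) ^ t = c⁻¹ * (a ^ s * b ^ t) := by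
    intro a b
    rw [ENNReal.mul_rpow_of_nonneg _ _ hs.le, ENNReal.mul_rpow_of_nonneg _ _ ht.le,
      ENNReal.inv_rpow, ENNReal.inv_rpow, hc, ENNReal.mul_inv (Or.inl hFs0) (Or.inl hFs)]
    ring
  have := (ENNReal.geom_mean_le_arith_mean2_weighted hs ht hst _ _).trans <|
    lintegral_add_le_of_forall_rpow_mul_rpow_le hs ht hst
    (f := fun x => F⁻¹ * f x) (g := fun x => G⁻¹ * g x) (h := fun x => c⁻¹ * h x)
    (hf.const_mul _) (hg.const_mul _) (hh.const_mul _)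
    (fun x y => by rw [key]; gcongr; exact hfgh x y)
    (by rw [← ENNReal.mul_iSup, ENNReal.inv_mul_cancel hF0 hfb])
    (by rw [← ENNReal.mul_iSup, ENNReal.inv_mul_cancel hG0 hgb])
  rw [lintegral_const_mul _ hf, lintegral_const_mul _ hg, lintegral_const_mul _ hh, key] at this
  rwa [ENNReal.mul_le_mul_iff_right (by simpa using hct) (by simpa using hc0)] at this

theorem prekopaLeindler_real : PrekopaLeindler (volume : Measure ℝ) := by
  intro s t hs ht hst f g h hf hg hh hfgh
  by_cases hf0 : ∫⁻ x, f x = 0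
  · simp [hf0, hs]
  by_cases hg0 : ∫⁻ x, g x = 0
  · simp [hg0, ht]
  have hlim : ∀ {φ : ℝ → ℝ≥0∞}, Measurable φ →
      Filter.Tendsto (fun m : ℕ => ∫⁻ x, min (φ x) m) Filter.atTop (nhds (∫⁻ x, φ x)) := by
    intro φ hφ
    refine lintegral_tendsto_of_tendsto_of_monotone
      (fun m => (hφ.min measurable_const).aemeasurable) ?_ ?_
    · filter_upwards with x m n hmn
      exact min_le_min le_rfl (by exact_mod_cast hmn)
    · filter_upwards with x
      have := (tendsto_const_nhds (x := φ x)).min ENNReal.tendsto_nat_nhds_top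
      simpa using this
  refine le_of_tendsto (ENNReal.Tendsto.mul
    ((ENNReal.continuous_rpow_const (y := s)).tendsto _ |>.comp (hlim hf)) (Or.inl ?_)
    ((ENNReal.continuous_rpow_const (y := t)).tendsto _ |>.comp (hlim hg)) (Or.inl ?_)) ?_
  · simp [hf0, hs.le]
  · simp [hg0, ht.le]
  · filter_upwards with m
    refine rpow_lintegral_mul_rpow_lintegral_le_of_bounded hs ht hst
      (hf.min measurable_const) (hg.min measurable_const) hh (fun x y => ?_) ?_ ?_
    · refine le_trans ?_ (hfgh x y)
      gcongr <;> exact min_le_left _ _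
    · exact ne_top_of_le_ne_top (ENNReal.natCast_ne_top m) (iSup_le fun x => min_le_right _ _)
    · exact ne_top_of_le_ne_top (ENNReal.natCast_ne_top m) (iSup_le fun x => min_le_right _ _)

theorem PrekopaLeindler.prod {E F : Type*} [AddCommGroup E] [Module ℝ E] [MeasurableSpace E]
    [AddCommGroup F] [Module ℝ F] [MeasurableSpace F] {μ : Measure E} {ν : Measure F}
    [SFinite ν] (hμ : PrekopaLeindler μ) (hν : PrekopaLeindler ν) :
    PrekopaLeindler (μ.prod ν) := by
  intro s t hs ht hst f g h hf hg hh hfgh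
  rw [lintegral_prod _ hf.aemeasurable, lintegral_prod _ hg.aemeasurable,
    lintegral_prod _ hh.aemeasurable]
  refine hμ hs ht hst hf.lintegral_prod_right' hg.lintegral_prod_right' hh.lintegral_prod_right'
    fun x₁ x₂ => ?_
  refine hν hs ht hst (hf.comp measurable_prodMk_left) (hg.comp measurable_prodMk_left)
    (hh.comp measurable_prodMk_left) fun y₁ y₂ => ?_
  exact hfgh (x₁, y₁) (x₂, y₂)

theorem PrekopaLeindler.of_measurePreserving {E F : Type*} [AddCommGroup E] [Module ℝ E]
    [MeasurableSpace E] [AddCommGroup F] [Module ℝ F] [MeasurableSpace F] {μ : Measure E}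
    {ν : Measure F} (hμ : PrekopaLeindler μ) (e : E →ₗ[ℝ] F) (he : MeasurePreserving e μ ν) :
    PrekopaLeindler ν := by
  intro s t hs ht hst f g h hf hg hh hfgh
  rw [← he.lintegral_comp hf, ← he.lintegral_comp hg, ← he.lintegral_comp hh]
  refine hμ hs ht hst (hf.comp he.measurable) (hg.comp he.measurable) (hh.comp he.measurable)
    fun x y => ?_
  simpa using hfgh (e x) (e y)

theorem prekopaLeindler_pi (n : ℕ) : PrekopaLeindler (volume : Measure (Fin n → ℝ)) := by
  induction n with
  | zero =>
    intro s t hs ht hst f g h hf hg hh hfgh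
    simp only [volume_pi, Measure.pi_of_empty _ (0 : Fin 0 → ℝ)]
    rw [lintegral_dirac, lintegral_dirac, lintegral_dirac]
    simpa using hfgh 0 0
  | succ n ih =>
    have hmp := (volume_preserving_piFinSuccAbove (fun _ : Fin (n + 1) => ℝ) 0).symm
    refine (prekopaLeindler_real.prod ih).of_measurePreserving
      { toFun := (MeasurableEquiv.piFinSuccAbove (fun _ : Fin (n + 1) => ℝ) 0).symm
        map_add' := fun x y => ?_
        map_smul' := fun c x => ?_ } hmp
    · ext i
      refine Fin.cases ?_ (fun j => ?_) i <;>
        simp [MeasurableEquiv.piFinSuccAbove, Fin.insertNthEquiv]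
    · ext i
      refine Fin.cases ?_ (fun j => ?_) i <;>
        simp [MeasurableEquiv.piFinSuccAbove, Fin.insertNthEquiv]

/-- The Prékopa–Leindler inequality in Euclidean space. -/
theorem prekopaLeindler_euclideanSpace (n : ℕ) :
    PrekopaLeindler (volume : Measure (EuclideanSpace ℝ (Fin n))) :=
  (prekopaLeindler_pi n).of_measurePreserving (WithLp.linearEquiv 2 ℝ (Fin n → ℝ)).symm.toLinearMap
    (PiLp.volume_preserving_toLp (Fin n))

theorem LipschitzWith.euclideanHausdorffMeasure_image_le {X Y : Type*} [EMetricSpace X]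
    [MeasurableSpace X] [BorelSpace X] [EMetricSpace Y] [MeasurableSpace Y] [BorelSpace Y]
    {K : ℝ≥0} {f : X → Y} (hf : LipschitzWith K f) (d : ℕ) (s : Set X) :
    μHE[d] (f '' s) ≤ (K : ℝ≥0∞) ^ d * μHE[d] s := by
  simp only [Measure.euclideanHausdorffMeasure_def, Measure.smul_apply, ENNReal.smul_def,
    smul_eq_mul]
  rw [mul_left_comm]
  gcongr
  simpa using hf.hausdorffMeasure_image_le (Nat.cast_nonneg d) s

theorem finrank_orthogonal_span_singleton_eq {V : Type*} [NormedAddCommGroup V]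
    [InnerProductSpace ℝ V] [FiniteDimensional ℝ V] {k : ℕ}
    (hk : Module.finrank ℝ V = k + 1) {e : V} (he : ‖e‖ = 1) : Module.finrank ℝ (ℝ ∙ e)ᗮ = k := by
  have h1 := (ℝ ∙ e).finrank_add_finrank_orthogonal
  have h2 : Module.finrank ℝ (ℝ ∙ e) = 1 :=
    finrank_span_singleton (by rintro rfl; simp at he)
  omega

theorem volume_span_singleton_eq_map {V : Type*} [NormedAddCommGroup V] [InnerProductSpace ℝ V]
    [MeasurableSpace V] [BorelSpace V] {e : V} (he : ‖e‖ = 1) :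
    (volume : Measure (ℝ ∙ e)) = (volume : Measure ℝ).map
      (fun t => t • (⟨e, Submodule.mem_span_singleton_self e⟩ : (ℝ ∙ e))) := by
  have he0 : e ≠ 0 := by rintro rfl; simp at he
  have hne : (⟨e, Submodule.mem_span_singleton_self e⟩ : (ℝ ∙ e)) ≠ 0 := by
    simpa [Subtype.ext_iff] using he0
  rw [volume_eq_of_finrank_eq_one (finrank_span_singleton he0) hne]
  have : ‖(⟨e, Submodule.mem_span_singleton_self e⟩ : (ℝ ∙ e))‖ₑ = 1 := by
    rw [enorm_eq_iff_norm_eq.2 (show _ = ‖(1 : ℝ)‖ by simpa using he)]; simp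
  rw [this, one_smul]

section Geometry

variable {V : Type*} [NormedAddCommGroup V] [InnerProductSpace ℝ V] [MeasurableSpace V]
  [BorelSpace V] [FiniteDimensional ℝ V]

theorem measurePreserving_measurableEquivProd_volume (P : Submodule ℝ V) :
    MeasurePreserving (P.measurableEquivProd (0 : V)) volume volume := by
  have := P.measurePreserving_measurableEquivProd (0 : V)
  rwa [InnerProductSpace.euclideanHausdorffMeasure_eq_volume] at this

theorem volume_sweep_le_of_slab {k : ℕ} (hk : Module.finrank ℝ V = k + 1) {e : V}
    (he : ‖e‖ = 1) {E : Set V} {a η l : ℝ}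
    (hE : ∀ x ∈ E, ⟪e, x⟫ ∈ Icc a (a + η)) :
    volume {x | ∃ u ∈ Icc 0 l, x - u • e ∈ E} ≤ ENNReal.ofReal (l + η) * μHE[k] E := by
  set P := ℝ ∙ e with hP
  have hrank := finrank_orthogonal_span_singleton_eq hk he
  have hpe : Pᗮ.orthogonalProjectionOnto e = 0 := by
    rw [Submodule.orthogonalProjectionOnto_eq_zero_iff, Submodule.orthogonal_orthogonal]
    exact Submodule.mem_span_singleton_self e
  have hee : ⟪e, e⟫ = 1 := by rw [real_inner_self_eq_norm_sq, he]; norm_num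
  have hsub : {x | ∃ u ∈ Icc 0 l, x - u • e ∈ E} ⊆ P.measurableEquivProd (0 : V) ⁻¹'
      ({p : P | ⟪e, (p : V)⟫ ∈ Icc a (a + η + l)} ×ˢ (Pᗮ.orthogonalProjectionOnto '' E)) := by
    rintro x ⟨u, hu, hx⟩
    refine mem_preimage.2 (mem_prod.2 ⟨?_, ?_⟩)
    · have hin : ⟪e, ((P.orthogonalProjectionOnto x : P) : V)⟫ = ⟪e, x⟫ := by
        have := Submodule.inner_orthogonalProjectionOnto_eq_of_mem_right
          (⟨e, Submodule.mem_span_singleton_self e⟩ : P) x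
        exact (real_inner_comm _ _).trans (this.trans (real_inner_comm _ _))
      have := hE _ hx
      rw [inner_sub_right, real_inner_smul_right, hee] at this
      simp only [Submodule.measurableEquivProd_apply, vsub_eq_sub, sub_zero, mem_ofPred_eq, hin]
      constructor <;> linarith [this.1, this.2, hu.1, hu.2]
    · refine ⟨_, hx, ?_⟩
      simp [map_sub, hpe]
  refine (measure_mono hsub).trans ?_
  rw [(measurePreserving_measurableEquivProd_volume P).measure_preimage_equiv,
    Measure.volume_eq_prod, Measure.prod_prod]
  gcongr
  · rw [volume_span_singleton_eq_map he, Measure.map_apply (by fun_prop)]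
    · have : ((fun t : ℝ => t • (⟨e, Submodule.mem_span_singleton_self e⟩ : P)) ⁻¹'
          {p : P | ⟪e, (p : V)⟫ ∈ Icc a (a + η + l)}) = Icc a (a + η + l) := by
        ext t
        simp [real_inner_smul_right, he]
      rw [this, Real.volume_Icc]
      exact ENNReal.ofReal_le_ofReal (by linarith)
    · exact (by fun_prop : Measurable fun p : P => ⟪e, (p : V)⟫) measurableSet_Icc
  · rw [← InnerProductSpace.euclideanHausdorffMeasure_eq_volume, hrank]
    simpa using (Pᗮ.lipschitzWith_orthogonalProjectionOnto).euclideanHausdorffMeasure_image_le k E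

/-- The volume swept out by a hypersurface translated along a segment is at most the length of the
segment times the area of the hypersurface. -/
theorem volume_sweep_le {k : ℕ} (hk : Module.finrank ℝ V = k + 1) {e : V} (he : ‖e‖ = 1)
    {E : Set V} (hE : MeasurableSet E) {l : ℝ} (hl : 0 < l) :
    volume {x | ∃ u ∈ Icc 0 l, x - u • e ∈ E} ≤ ENNReal.ofReal l * μHE[k] E := by
  by_cases hfin : μHE[k] E = ∞
  · simp [hfin, ENNReal.mul_top, hl]
  have key : ∀ η : ℝ, 0 < η →
      volume {x | ∃ u ∈ Icc 0 l, x - u • e ∈ E} ≤ ENNReal.ofReal (l + η) * μHE[k] E := by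
    intro η hη
    set S : ℤ → Set V := fun i => {x | ⟪e, x⟫ ∈ Ico ((i : ℝ) * η) ((i + 1 : ℤ) * η)} with hS
    have hSm : ∀ i, MeasurableSet (S i) := fun i =>
      (by fun_prop : Measurable fun x : V => ⟪e, x⟫) measurableSet_Ico
    have hSd : Pairwise (Function.onFun Disjoint S) := by
      intro i j hij
      have := (pairwise_disjoint_Ico_zsmul η) hij
      simp only [zsmul_eq_mul] at this
      refine Set.disjoint_left.2 fun x hx hx' => Set.disjoint_left.1 this hx hx'
    have hSU : ⋃ i, S i = univ := by
      refine eq_univ_of_forall fun x => ?_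
      have : ⟪e, x⟫ ∈ ⋃ i : ℤ, Ico (i • η) ((i + 1) • η) := by
        rw [iUnion_Ico_zsmul hη]; trivial
      simp only [zsmul_eq_mul] at this
      obtain ⟨i, hi⟩ := mem_iUnion.1 this
      exact mem_iUnion.2 ⟨i, hi⟩
    calc volume {x | ∃ u ∈ Icc 0 l, x - u • e ∈ E}
        ≤ volume (⋃ i, {x | ∃ u ∈ Icc 0 l, x - u • e ∈ E ∩ S i}) := by
          refine measure_mono ?_
          rintro x ⟨u, hu, hx⟩
          have : x - u • e ∈ ⋃ i, S i := hSU ▸ mem_univ _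
          obtain ⟨i, hi⟩ := mem_iUnion.1 this
          exact mem_iUnion.2 ⟨i, u, hu, hx, hi⟩
      _ ≤ ∑' i, volume {x | ∃ u ∈ Icc 0 l, x - u • e ∈ E ∩ S i} := measure_iUnion_le _
      _ ≤ ∑' i, ENNReal.ofReal (l + η) * μHE[k] (E ∩ S i) := by
          refine ENNReal.tsum_le_tsum fun i => ?_
          refine volume_sweep_le_of_slab hk he (a := i * η) fun x hx => ?_
          have := hx.2
          refine ⟨this.1, this.2.le.trans (le_of_eq ?_)⟩
          push_cast; ring
      _ = ENNReal.ofReal (l + η) * μHE[k] E := by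
          rw [ENNReal.tsum_mul_left, ← measure_iUnion
            (fun i j hij => (hSd hij).mono inter_subset_right inter_subset_right)
            (fun i => hE.inter (hSm i)), ← inter_iUnion, hSU, inter_univ]
  have hlim : Filter.Tendsto (fun η : ℝ => ENNReal.ofReal (l + η) * μHE[k] E)
      (nhdsWithin 0 (Ioi 0)) (nhds (ENNReal.ofReal l * μHE[k] E)) := by
    refine ENNReal.Tendsto.mul_const ?_ (Or.inr hfin)
    have : Filter.Tendsto (fun η : ℝ => ENNReal.ofReal (l + η)) (nhds 0)
        (nhds (ENNReal.ofReal (l + 0))) :=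
      (ENNReal.continuous_ofReal.comp (continuous_const_add l)).tendsto 0
    rw [add_zero] at this
    exact this.mono_left nhdsWithin_le_nhds
  exact ge_of_tendsto hlim (Filter.eventually_of_mem self_mem_nhdsWithin fun η hη => key η hη)

end Geometry

theorem norm_normalize_sub_normalize_le {V : Type*} [NormedAddCommGroup V] [InnerProductSpace ℝ V]
    {x y : V} (hx : 1 ≤ ‖x‖) (hy : 1 ≤ ‖y‖) : ‖‖x‖⁻¹ • x - ‖y‖⁻¹ • y‖ ≤ ‖x - y‖ := by
  have hx0 : 0 < ‖x‖ := by linarith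
  have hy0 : 0 < ‖y‖ := by linarith
  refine le_of_sq_le_sq ?_ (norm_nonneg _)
  rw [norm_sub_sq_real, norm_sub_sq_real, norm_smul, norm_smul, real_inner_smul_left,
    real_inner_smul_right, norm_inv, norm_inv, norm_norm, norm_norm, inv_mul_cancel₀ hx0.ne',
    inv_mul_cancel₀ hy0.ne']
  obtain ⟨c, hc⟩ : ∃ c, ⟪x, y⟫ = ‖x‖ * ‖y‖ * c :=
    ⟨⟪x, y⟫ / (‖x‖ * ‖y‖), by field_simp⟩
  have hc1 : c ≤ 1 := by
    have := real_inner_le_norm x y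
    rw [hc] at this
    by_contra! h
    nlinarith [mul_pos hx0 hy0]
  have : ‖x‖⁻¹ * (‖y‖⁻¹ * ⟪x, y⟫) = c := by rw [hc]; field_simp
  rw [this, hc]
  nlinarith [sq_nonneg (‖x‖ - ‖y‖), mul_nonneg (sub_nonneg.2 hc1)
    (sub_nonneg.2 (one_le_mul_of_one_le_of_one_le hx hy))]

section Sphere

variable {V : Type*} [NormedAddCommGroup V] [InnerProductSpace ℝ V] [MeasurableSpace V]
  [BorelSpace V] [FiniteDimensional ℝ V]

open scoped Pointwise in
theorem volume_cone {k : ℕ} (hk : Module.finrank ℝ V = k + 1) {e : V} (he : ‖e‖ = 1)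
    {G : Set (ℝ ∙ e)ᗮ} (hG : MeasurableSet G) :
    volume {x : V | ⟪e, x⟫ ∈ Ioo (0 : ℝ) 1 ∧
      (⟪e, x⟫)⁻¹ • (ℝ ∙ e)ᗮ.orthogonalProjectionOnto x ∈ G} * (k + 1) = volume G := by
  have hrank := finrank_orthogonal_span_singleton_eq hk he
  set T : Set (ℝ × (ℝ ∙ e)ᗮ) := {p | p.1 ∈ Ioo (0 : ℝ) 1 ∧ p.1⁻¹ • p.2 ∈ G} with hT
  have hTm : MeasurableSet T :=
    (measurable_fst measurableSet_Ioo).inter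
      ((by fun_prop : Measurable fun p : ℝ × (ℝ ∙ e)ᗮ => p.1⁻¹ • p.2) hG)
  have hmp : MeasurePreserving
      (fun t : ℝ => t • (⟨e, Submodule.mem_span_singleton_self e⟩ : (ℝ ∙ e))) volume volume :=
    ⟨by fun_prop, (volume_span_singleton_eq_map he).symm⟩
  have hin : ∀ x : V, ⟪e, (((ℝ ∙ e).orthogonalProjectionOnto x : (ℝ ∙ e)) : V)⟫ = ⟪e, x⟫ := by
    intro x
    have := Submodule.inner_orthogonalProjectionOnto_eq_of_mem_right
      (⟨e, Submodule.mem_span_singleton_self e⟩ : (ℝ ∙ e)) x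
    exact (real_inner_comm _ _).trans (this.trans (real_inner_comm _ _))
  set U : Set ((ℝ ∙ e) × (ℝ ∙ e)ᗮ) := {p | (⟪e, (p.1 : V)⟫, p.2) ∈ T} with hU
  have hUm : MeasurableSet U :=
    (by fun_prop : Measurable fun p : (ℝ ∙ e) × (ℝ ∙ e)ᗮ => (⟪e, (p.1 : V)⟫, p.2)) hTm
  have h1 : {x : V | ⟪e, x⟫ ∈ Ioo (0 : ℝ) 1 ∧
      (⟪e, x⟫)⁻¹ • (ℝ ∙ e)ᗮ.orthogonalProjectionOnto x ∈ G} =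
      (ℝ ∙ e).measurableEquivProd (0 : V) ⁻¹' U := by
    ext x
    simp only [hU, hT, mem_preimage, Submodule.measurableEquivProd_apply, vsub_eq_sub, sub_zero,
      mem_ofPred_eq, hin]
  have h2 : (volume : Measure ((ℝ ∙ e) × (ℝ ∙ e)ᗮ)) U = volume T := by
    have h := (hmp.prod (MeasurePreserving.id (volume : Measure (ℝ ∙ e)ᗮ))).measure_preimage
      hUm.nullMeasurableSet
    rw [← Measure.volume_eq_prod, ← Measure.volume_eq_prod] at h
    rw [← h]
    congr 1
    ext p
    simp [hU, real_inner_smul_right, he]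
  rw [h1, (measurePreserving_measurableEquivProd_volume (ℝ ∙ e)).measure_preimage_equiv, h2,
    Measure.volume_eq_prod, Measure.prod_apply hTm]
  have h3 : ∀ t : ℝ, volume (Prod.mk t ⁻¹' T) =
      (Ioo (0 : ℝ) 1).indicator (fun t => ENNReal.ofReal (t ^ k) * volume G) t := by
    intro t
    by_cases ht : t ∈ Ioo (0 : ℝ) 1
    · have : Prod.mk t ⁻¹' T = t • G := by
        ext q
        rw [mem_smul_set_iff_inv_smul_mem₀ ht.1.ne']
        simp [hT, ht.1, ht.2]
      rw [this, Measure.addHaar_smul, hrank, indicator_of_mem ht, abs_of_pos (pow_pos ht.1 k)]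
    · rw [indicator_of_notMem ht]
      have : Prod.mk t ⁻¹' T = ∅ := by
        ext q
        simp only [hT, mem_preimage, mem_ofPred_eq, mem_empty_iff_false, iff_false]
        exact fun h => ht h.1
      rw [this, measure_empty]
  simp_rw [h3]
  rw [lintegral_indicator measurableSet_Ioo, lintegral_mul_const _ (by fun_prop)]
  have h4 : (∫⁻ t in Ioo (0 : ℝ) 1, ENNReal.ofReal (t ^ k)) = ENNReal.ofReal (1 / (k + 1)) := by
    rw [← ofReal_integral_eq_lintegral_ofReal]
    · rw [← integral_Ioc_eq_integral_Ioo, ← intervalIntegral.integral_of_le zero_le_one,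
        integral_pow]
      simp
    · exact ((continuous_pow k).integrableOn_Icc (a := 0) (b := 1)).mono_set Ioo_subset_Icc_self
    · filter_upwards [ae_restrict_mem measurableSet_Ioo] with t ht using pow_nonneg ht.1.le k
  rw [h4, mul_right_comm]
  have : ENNReal.ofReal (1 / (k + 1)) * (k + 1) = 1 := by
    rw [← ENNReal.ofReal_natCast, ← ENNReal.ofReal_one, ← ENNReal.ofReal_add (by positivity)
      zero_le_one, ← ENNReal.ofReal_mul (by positivity)]
    congr 1
    field_simp
  rw [this, one_mul]

open scoped Pointwise in
theorem euclideanHausdorffMeasure_cap_le {k : ℕ} (hk : Module.finrank ℝ V = k + 1) {e : V}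
    (he : ‖e‖ = 1) {s : ℝ} (hs : 0 < s) {E : Set V} (hEm : MeasurableSet E)
    (hE : E ⊆ sphere 0 1) (hEs : ∀ x ∈ E, s < ⟪e, x⟫) :
    ENNReal.ofReal (s ^ (k + 1)) * μHE[k] E ≤ (k + 1) * volume (Ioo (0 : ℝ) 1 • E) := by
  set P := ℝ ∙ e with hP
  have hee : ⟪e, e⟫ = 1 := by rw [real_inner_self_eq_norm_sq, he]; norm_num
  have heq : ∀ q : Pᗮ, ⟪e, (q : V)⟫ = 0 := fun q =>
    Submodule.mem_orthogonal_singleton_iff_inner_right.1 q.2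
  have hin : ∀ q : Pᗮ, ⟪e, e + (q : V)⟫ = 1 := fun q => by
    rw [inner_add_right, hee, heq, add_zero]
  have hnorm : ∀ q : Pᗮ, 1 ≤ ‖e + (q : V)‖ := fun q => by
    have := real_inner_le_norm e (e + (q : V))
    rwa [hin, he, one_mul] at this
  set ψ : Pᗮ → V := fun q => ‖e + (q : V)‖⁻¹ • (e + (q : V)) with hψ
  have hψL : LipschitzWith 1 ψ := LipschitzWith.of_dist_le_mul fun q q' => by
    rw [dist_eq_norm, dist_eq_norm, NNReal.coe_one, one_mul]
    refine (norm_normalize_sub_normalize_le (hnorm q) (hnorm q')).trans ?_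
    rw [add_sub_add_left_eq_sub]
    exact le_rfl
  set G : Set Pᗮ := ψ ⁻¹' E with hG
  have hGm : MeasurableSet G := hψL.continuous.measurable hEm
  have hdecomp : ∀ x : V, x = ⟪e, x⟫ • e + (Pᗮ.orthogonalProjectionOnto x : V) := fun x => by
    conv_lhs => rw [← P.starProjection_add_starProjection_orthogonal x]
    rw [Submodule.starProjection_unit_singleton ℝ he]
    rfl
  have h1 : μHE[k] E ≤ volume G := by
    have hEG : E ⊆ ψ '' G := by
      intro x hx
      have hc : 0 < ⟪e, x⟫ := hs.trans (hEs x hx)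
      have hx1 : ‖x‖ = 1 := by simpa using hE hx
      have hq : e + (((⟪e, x⟫)⁻¹ • Pᗮ.orthogonalProjectionOnto x : Pᗮ) : V) = (⟪e, x⟫)⁻¹ • x := by
        conv_rhs => rw [congrArg (fun y => (⟪e, x⟫)⁻¹ • y) (hdecomp x)]
        rw [smul_add, smul_smul, inv_mul_cancel₀ hc.ne', one_smul, Submodule.coe_smul]
      have : ψ ((⟪e, x⟫)⁻¹ • Pᗮ.orthogonalProjectionOnto x) = x := by
        simp only [hψ, hq]
        rw [norm_smul, hx1, mul_one, norm_inv, inv_inv, smul_smul, Real.norm_of_nonneg hc.le,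
          mul_inv_cancel₀ hc.ne', one_smul]
      exact ⟨_, by rwa [hG, mem_preimage, this], this⟩
    refine (measure_mono hEG).trans ((hψL.euclideanHausdorffMeasure_image_le k G).trans ?_)
    rw [ENNReal.coe_one, one_pow, one_mul, ← InnerProductSpace.euclideanHausdorffMeasure_eq_volume,
      finrank_orthogonal_span_singleton_eq hk he]
  set C := {x : V | ⟪e, x⟫ ∈ Ioo (0 : ℝ) 1 ∧
      (⟪e, x⟫)⁻¹ • Pᗮ.orthogonalProjectionOnto x ∈ G} with hC
  have h2 : s • C ⊆ Ioo (0 : ℝ) 1 • E := by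
    rintro _ ⟨x, ⟨hx1, hx2⟩, rfl⟩
    set q := (⟪e, x⟫)⁻¹ • Pᗮ.orthogonalProjectionOnto x with hq
    have hx : x = ⟪e, x⟫ • (e + (q : V)) := by
      conv_lhs => rw [hdecomp x]
      rw [hq, smul_add, Submodule.coe_smul, smul_smul, mul_inv_cancel₀ hx1.1.ne', one_smul]
    have hn : 0 < ‖e + (q : V)‖ := zero_lt_one.trans_le (hnorm q)
    have hlt := hEs _ hx2
    simp only [hψ] at hlt
    rw [real_inner_smul_right, hin, mul_one, lt_inv_comm₀ hs hn] at hlt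
    refine mem_smul.2 ⟨s * ⟪e, x⟫ * ‖e + (q : V)‖, ⟨?_, ?_⟩, ψ q, hx2, ?_⟩
    · have := hx1.1
      positivity
    · have h3 : s * ‖e + (q : V)‖ < 1 := by
        rwa [← lt_inv_mul_iff₀ hs, mul_one]
      nlinarith [hx1.1, hx1.2, mul_pos hs hn]
    · simp only [hψ]
      rw [smul_smul, mul_assoc, mul_inv_cancel₀ hn.ne', mul_one, ← smul_smul, ← hx]
  calc ENNReal.ofReal (s ^ (k + 1)) * μHE[k] E ≤ ENNReal.ofReal (s ^ (k + 1)) * volume G := by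
        gcongr
    _ = (k + 1) * volume (s • C) := by
        rw [← volume_cone hk he hGm, Measure.addHaar_smul, hk, abs_of_pos (pow_pos hs _)]
        ring
    _ ≤ _ := by gcongr

theorem euclideanHausdorffMeasure_le_toSphere {k : ℕ} (hk : Module.finrank ℝ V = k + 1)
    {T : Set (sphere (0 : V) 1)} (hT : MeasurableSet T) :
    μHE[k] ((↑) '' T : Set V) ≤ (volume : Measure V).toSphere T := by
  have : Nontrivial V := Module.nontrivial_of_finrank_pos (R := ℝ) (by omega)
  have : Nonempty (sphere (0 : V) 1) := (NormedSpace.sphere_nonempty.2 zero_le_one).to_subtype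
  have hemb : MeasurableEmbedding ((↑) : sphere (0 : V) 1 → V) :=
    MeasurableEmbedding.subtype_coe isClosed_sphere.measurableSet
  have key : ∀ s : ℝ, 0 < s → s < 1 →
      ENNReal.ofReal (s ^ (k + 1)) * μHE[k] ((↑) '' T : Set V) ≤
        (volume : Measure V).toSphere T := by
    intro s hs hs1
    set d := TopologicalSpace.denseSeq (sphere (0 : V) 1) with hd
    set U : ℕ → Set (sphere (0 : V) 1) := fun i => {x | s < ⟪(d i : V), (x : V)⟫} with hU
    have hUm : ∀ i, MeasurableSet (U i) := fun i =>
      measurableSet_lt measurable_const (by fun_prop)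
    have hUU : ⋃ i, disjointed U i = univ := by
      rw [iUnion_disjointed]
      refine eq_univ_of_forall fun x => ?_
      have ho : IsOpen {y : sphere (0 : V) 1 | s < ⟪(y : V), (x : V)⟫} :=
        isOpen_lt continuous_const (by fun_prop)
      obtain ⟨y, hy, i, rfl⟩ := (TopologicalSpace.denseRange_denseSeq _).inter_open_nonempty _ ho
        ⟨x, by
          have : ‖(x : V)‖ = 1 := by simp
          simp [this, hs1]⟩
      exact mem_iUnion.2 ⟨i, hy⟩
    have hdis := disjoint_disjointed U
    have hTU : T = ⋃ i, T ∩ disjointed U i := by rw [← inter_iUnion, hUU, inter_univ]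
    have hpm : ∀ i, MeasurableSet (T ∩ disjointed U i) := fun i =>
      hT.inter (MeasurableSet.disjointed hUm i)
    have hpd : Pairwise (Function.onFun Disjoint fun i => T ∩ disjointed U i) := fun i j hij =>
      (hdis hij).mono inter_subset_right inter_subset_right
    conv_lhs => rw [hTU, image_iUnion]
    conv_rhs => rw [hTU]
    rw [measure_iUnion hpd hpm]
    refine (mul_le_mul_right (measure_iUnion_le _) _).trans ?_
    rw [← ENNReal.tsum_mul_left]
    refine ENNReal.tsum_le_tsum fun i => ?_
    rw [Measure.toSphere_apply' _ (hpm i), hk]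
    push_cast
    refine euclideanHausdorffMeasure_cap_le hk (e := (d i : V)) (by simp) hs
      (hemb.measurableSet_image.2 (hpm i)) ?_ ?_
    · rintro _ ⟨x, -, rfl⟩
      exact x.2
    · rintro _ ⟨x, hx, rfl⟩
      exact disjointed_subset U i hx.2
  have hlim : Filter.Tendsto (fun s : ℝ => ENNReal.ofReal (s ^ (k + 1)) *
      μHE[k] ((↑) '' T : Set V)) (nhdsWithin 1 (Iio 1))
      (nhds (ENNReal.ofReal (1 ^ (k + 1)) * μHE[k] ((↑) '' T : Set V))) := by
    refine ENNReal.Tendsto.mul_const ?_ (Or.inl (by simp))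
    exact ((ENNReal.continuous_ofReal.comp (continuous_pow (k + 1))).tendsto 1).mono_left
      nhdsWithin_le_nhds
  rw [one_pow, ENNReal.ofReal_one, one_mul] at hlim
  exact le_of_tendsto hlim (Filter.eventually_of_mem (Ioo_mem_nhdsLT zero_lt_one)
    fun s hs => key s hs.1 hs.2)

end Sphere

section Polar

variable {V : Type*} [NormedAddCommGroup V] [InnerProductSpace ℝ V] [MeasurableSpace V]
  [BorelSpace V] [FiniteDimensional ℝ V]

theorem lintegral_rpow_volumeIoiPow (k : ℕ) {α : ℝ} (hα : 0 ≤ α) :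
    ∫⁻ r : Ioi (0 : ℝ), (Iio (1 : ℝ)).indicator (fun r => ENNReal.ofReal (r ^ α)) r
      ∂(Measure.volumeIoiPow k) = ENNReal.ofReal (1 / (k + 1 + α)) := by
  have hm : Measurable fun r : ℝ => (Iio (1 : ℝ)).indicator (fun r => ENNReal.ofReal (r ^ α)) r :=
    Measurable.indicator (by fun_prop) measurableSet_Iio
  rw [Measure.volumeIoiPow, lintegral_withDensity_eq_lintegral_mul _ (by fun_prop)
    (g := fun r : Ioi (0 : ℝ) => (Iio (1 : ℝ)).indicator (fun r => ENNReal.ofReal (r ^ α)) r)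
    (by fun_prop)]
  simp only [Pi.mul_apply]
  rw [lintegral_subtype_comap measurableSet_Ioi (fun r : ℝ => ENNReal.ofReal (r ^ k) *
    (Iio (1 : ℝ)).indicator (fun r => ENNReal.ofReal (r ^ α)) r)]
  have h1 : ∀ r : ℝ, ENNReal.ofReal (r ^ k) *
      (Iio (1 : ℝ)).indicator (fun r => ENNReal.ofReal (r ^ α)) r =
      (Iio (1 : ℝ)).indicator (fun r => ENNReal.ofReal (r ^ k) * ENNReal.ofReal (r ^ α)) r := by
    intro r
    by_cases hr : r ∈ Iio (1 : ℝ) <;> simp [hr]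
  simp_rw [h1]
  rw [lintegral_indicator measurableSet_Iio, Measure.restrict_restrict measurableSet_Iio,
    inter_comm, Ioi_inter_Iio]
  have h2 : ∫⁻ r in Ioo (0 : ℝ) 1, ENNReal.ofReal (r ^ k) * ENNReal.ofReal (r ^ α) =
      ∫⁻ r in Ioo (0 : ℝ) 1, ENNReal.ofReal (r ^ (k + α)) := by
    refine setLIntegral_congr_fun measurableSet_Ioo fun r hr => ?_
    have := pow_nonneg hr.1.le k
    simp only [← ENNReal.ofReal_mul this, Real.rpow_add hr.1, Real.rpow_natCast]
  have hk : -1 < (k : ℝ) + α := by linarith [(Nat.cast_nonneg k : (0 : ℝ) ≤ k)]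
  rw [h2, ← ofReal_integral_eq_lintegral_ofReal]
  · rw [← integral_Ioc_eq_integral_Ioo, ← intervalIntegral.integral_of_le zero_le_one,
      integral_rpow (Or.inl hk), Real.one_rpow, Real.zero_rpow (by linarith), sub_zero]
    congr 2
    ring
  · exact ((intervalIntegral.intervalIntegrable_rpow' hk).1).mono_set Ioo_subset_Ioc_self
  · filter_upwards [ae_restrict_mem measurableSet_Ioo] with t ht using Real.rpow_nonneg ht.1.le _

theorem lintegral_toSphere_of_homogeneous {k : ℕ} (hk : Module.finrank ℝ V = k + 1)
    {f : V → ℝ≥0∞} (hf : Measurable f) {α : ℝ} (hα : 0 ≤ α)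
    (hom : ∀ t : ℝ, 0 < t → ∀ x, f (t • x) = ENNReal.ofReal (t ^ α) * f x) :
    ∫⁻ x : sphere (0 : V) 1, f x ∂(volume : Measure V).toSphere =
      ENNReal.ofReal (k + 1 + α) * ∫⁻ x in ball (0 : V) 1, f x := by
  have : Nontrivial V := Module.nontrivial_of_finrank_pos (R := ℝ) (by omega)
  set h : ℝ → ℝ≥0∞ := fun r => (Iio (1 : ℝ)).indicator (fun r => ENNReal.ofReal (r ^ α)) r
    with hh
  have hhm : Measurable h := Measurable.indicator (by fun_prop) measurableSet_Iio
  have h1 : ∫⁻ x in ball (0 : V) 1, f x =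
      ∫⁻ x : ({0}ᶜ : Set V), (ball (0 : V) 1).indicator f x ∂(volume : Measure V).comap (↑) := by
    rw [lintegral_subtype_comap (measurableSet_singleton 0).compl, restrict_compl_singleton,
      lintegral_indicator measurableSet_ball]
  have h2 : ∀ x : ({0}ᶜ : Set V), (ball (0 : V) 1).indicator f x =
      (fun p : sphere (0 : V) 1 × Ioi (0 : ℝ) => f p.1 * h p.2) (homeomorphUnitSphereProd V x) := by
    intro x
    have hx : 0 < ‖(x : V)‖ := norm_pos_iff.2 x.2
    have hx2 : (x : V) = ‖(x : V)‖ • (‖(x : V)‖⁻¹ • (x : V)) := by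
      rw [smul_smul, mul_inv_cancel₀ hx.ne', one_smul]
    simp only [homeomorphUnitSphereProd_apply_fst_coe, homeomorphUnitSphereProd_apply_snd_coe, hh]
    by_cases hx1 : ‖(x : V)‖ < 1
    · rw [indicator_of_mem (by simpa using hx1), indicator_of_mem (by simpa using hx1), mul_comm,
        ← hom _ hx, ← hx2]
    · rw [indicator_of_notMem (by simpa using hx1), indicator_of_notMem (by simpa using hx1),
        mul_zero]
  simp_rw [h1, h2]
  rw [(Measure.measurePreserving_homeomorphUnitSphereProd (volume : Measure V)).lintegral_comp_emb
    (Homeomorph.measurableEmbedding _)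
    (fun p : sphere (0 : V) 1 × Ioi (0 : ℝ) => f p.1 * h p.2),
    lintegral_prod_mul (f := fun x : sphere (0 : V) 1 => f x)
    (g := fun r : Ioi (0 : ℝ) => h r) (by fun_prop) (by fun_prop), hk,
    Nat.add_sub_cancel, lintegral_rpow_volumeIoiPow k hα, mul_left_comm,
    ← ENNReal.ofReal_mul (by positivity), mul_one_div_cancel (by positivity), ENNReal.ofReal_one,
    mul_one]

theorem lintegral_sphere_le_of_homogeneous {k : ℕ} (hk : Module.finrank ℝ V = k + 1)
    {f : V → ℝ≥0∞} (hf : Measurable f) {α : ℝ} (hα : 0 ≤ α)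
    (hom : ∀ t : ℝ, 0 < t → ∀ x, f (t • x) = ENNReal.ofReal (t ^ α) * f x) :
    ∫⁻ x in sphere (0 : V) 1, f x ∂μHE[k] ≤
      ENNReal.ofReal (k + 1 + α) * ∫⁻ x in ball (0 : V) 1, f x := by
  rw [← lintegral_toSphere_of_homogeneous hk hf hα hom,
    ← lintegral_subtype_comap isClosed_sphere.measurableSet]
  refine lintegral_mono' (Measure.le_iff.2 fun T hT => ?_) le_rfl
  rw [comap_subtype_coe_apply isClosed_sphere.measurableSet]
  exact euclideanHausdorffMeasure_le_toSphere hk hT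

end Polar

theorem IsPreconnected.inter_frontier_nonempty {X : Type*} [TopologicalSpace X] {s t : Set X}
    (hs : IsPreconnected s) (h1 : (s ∩ t).Nonempty) (h2 : (s ∩ tᶜ).Nonempty) :
    (s ∩ frontier t).Nonempty := by
  by_contra! h
  have hcov : ∀ x ∈ s, x ∈ interior t ∨ x ∈ (closure t)ᶜ := fun x hx => by
    by_contra! hx'
    exact (h ▸ ⟨hx, notMem_compl_iff.1 hx'.2, hx'.1⟩ : x ∈ (∅ : Set X))
  obtain ⟨x, hx, hxt⟩ := h1
  obtain ⟨y, hy, hyt⟩ := h2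
  obtain ⟨z, -, hz1, hz2⟩ := hs _ _ isOpen_interior isClosed_closure.isOpen_compl hcov
    ⟨x, hx, (hcov x hx).resolve_right fun h' => h' (subset_closure hxt)⟩
    ⟨y, hy, (hcov y hy).resolve_left fun h' => hyt (interior_subset h')⟩
  exact hz2 (interior_subset_closure hz1)

theorem frontier_inter_ball_subset_of_epigraph {V : Type*} [NormedAddCommGroup V]
    [InnerProductSpace ℝ V] {Ω : Set V} (hΩ : IsOpen Ω) {x v : V} {r : ℝ}
    {φ : V → ℝ} (hφ : Continuous φ)
    (h : ∀ y ∈ ball x r, (y ∈ Ω ↔ φ (y - ⟪y, v⟫ • v) < ⟪y, v⟫)) :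
    frontier Ω ∩ ball x r ⊆ {y | φ (y - ⟪y, v⟫ • v) = ⟪y, v⟫} := by
  rintro y ⟨hy, hyr⟩
  rw [hΩ.frontier_eq] at hy
  have h1 : ⟪y, v⟫ ≤ φ (y - ⟪y, v⟫ • v) := not_lt.1 fun h' => hy.2 ((h y hyr).2 h')
  refine le_antisymm ?_ h1
  by_contra! hlt
  have ho : IsOpen ({y | ⟪y, v⟫ < φ (y - ⟪y, v⟫ • v)} ∩ ball x r) :=
    (isOpen_lt (by fun_prop) (by fun_prop)).inter isOpen_ball
  obtain ⟨z, ⟨hz1, hz2⟩, hz3⟩ := mem_closure_iff.1 hy.1 _ ho ⟨hlt, hyr⟩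
  exact lt_asymm hz1 ((h z hz2).1 hz3)

section Boundary

variable {V : Type*} [NormedAddCommGroup V] [InnerProductSpace ℝ V] [MeasurableSpace V]
  [BorelSpace V] [FiniteDimensional ℝ V]

theorem volume_inter_ball_sub_le {k : ℕ} (hk : Module.finrank ℝ V = k + 1) {Ω : Set V}
    {b : V} {ε : ℝ} (hb : ‖b‖ < ε) (z : V) (r : ℝ) :
    volume (Ω ∩ ball (z - b) r) ≤
      volume (Ω ∩ ball z r) + ENNReal.ofReal ε * μHE[k] (frontier Ω ∩ ball z (r + ε)) := by
  rcases eq_or_ne b 0 with rfl | hb0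
  · simp
  have hb' : 0 < ‖b‖ := norm_pos_iff.2 hb0
  set e := ‖b‖⁻¹ • b with he
  have hen : ‖e‖ = 1 := by rw [he, norm_smul, norm_inv, norm_norm, inv_mul_cancel₀ hb'.ne']
  have hbe : b = ‖b‖ • e := by rw [he, smul_smul, mul_inv_cancel₀ hb'.ne', one_smul]
  have h1 : volume (Ω ∩ ball (z - b) r) = volume ((fun x => x - b) ⁻¹' (Ω ∩ ball (z - b) r)) := by
    simp_rw [sub_eq_add_neg]
    rw [measure_preimage_add_right]
  rw [h1]
  have h2 : (fun x => x - b) ⁻¹' (Ω ∩ ball (z - b) r) ⊆ (Ω ∩ ball z r) ∪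
      {x | ∃ u ∈ Icc 0 ‖b‖, x - u • e ∈ frontier Ω ∩ ball z (r + ε)} := by
    rintro x ⟨hx1, hx2⟩
    have hxz : x ∈ ball z r := by simpa [mem_ball, dist_eq_norm] using hx2
    by_cases hx : x ∈ Ω
    · exact Or.inl ⟨hx, hxz⟩
    right
    set γ : ℝ → V := fun u => x - u • e with hγ
    have hγc : Continuous γ := by fun_prop
    have hpre : IsPreconnected (γ '' Icc 0 ‖b‖) := isPreconnected_Icc.image _ hγc.continuousOn
    have hγ0 : γ 0 = x := by simp [hγ]
    have hγb : γ ‖b‖ = x - b := by simp [hγ, ← hbe]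
    obtain ⟨_, ⟨u, hu, rfl⟩, hy⟩ := hpre.inter_frontier_nonempty
      ⟨_, ⟨‖b‖, right_mem_Icc.2 hb'.le, rfl⟩, show γ ‖b‖ ∈ Ω from hγb ▸ hx1⟩
      ⟨_, ⟨0, left_mem_Icc.2 hb'.le, rfl⟩, show γ 0 ∈ Ωᶜ from hγ0 ▸ hx⟩
    refine ⟨u, hu, hy, ?_⟩
    rw [mem_ball, dist_eq_norm] at hxz ⊢
    calc ‖x - u • e - z‖ = ‖(x - z) - u • e‖ := by congr 1; abel
      _ ≤ ‖x - z‖ + ‖u • e‖ := norm_sub_le _ _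
      _ < r + ε := by
        rw [norm_smul, hen, mul_one, Real.norm_of_nonneg hu.1]
        linarith [hu.2]
  refine (measure_mono h2).trans ((measure_union_le _ _).trans ?_)
  gcongr
  refine (volume_sweep_le hk hen (isClosed_frontier.measurableSet.inter measurableSet_ball)
    hb').trans ?_
  gcongr

theorem euclideanHausdorffMeasure_graph_inter_ball_lt_top {k : ℕ}
    (hk : Module.finrank ℝ V = k + 1) {v : V} (hv : ‖v‖ = 1) {K : ℝ≥0} {φ : V → ℝ}
    (hφ : LipschitzWith K φ) (x : V) (r : ℝ) :
    μHE[k] ({y | φ (y - ⟪y, v⟫ • v) = ⟪y, v⟫} ∩ ball x r) < ∞ := by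
  set ψ : (ℝ ∙ v)ᗮ → V := fun q => (q : V) + φ q • v with hψ
  have hψL : LipschitzWith (1 + K) ψ := by
    refine LipschitzWith.add (ℝ ∙ v)ᗮ.subtypeₗᵢ.lipschitz ?_
    refine LipschitzWith.of_dist_le_mul fun q q' => ?_
    rw [dist_eq_norm, ← sub_smul, norm_smul, hv, mul_one, ← dist_eq_norm]
    exact hφ.dist_le_mul _ _
  have hsub : {y | φ (y - ⟪y, v⟫ • v) = ⟪y, v⟫} ∩ ball x r ⊆
      ψ '' ball ((ℝ ∙ v)ᗮ.orthogonalProjectionOnto x) r := by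
    rintro y ⟨hy, hyr⟩
    have hp : (((ℝ ∙ v)ᗮ.orthogonalProjectionOnto y : (ℝ ∙ v)ᗮ) : V) = y - ⟪y, v⟫ • v := by
      have := (ℝ ∙ v).starProjection_add_starProjection_orthogonal y
      rw [Submodule.starProjection_unit_singleton ℝ hv, real_inner_comm] at this
      exact eq_sub_of_add_eq' this
    refine ⟨(ℝ ∙ v)ᗮ.orthogonalProjectionOnto y, ?_, ?_⟩
    · rw [mem_ball] at hyr ⊢
      refine lt_of_le_of_lt ?_ hyr
      simpa using ((ℝ ∙ v)ᗮ.lipschitzWith_orthogonalProjectionOnto).dist_le_mul y x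
    · simp only [hψ, hp]
      rw [show φ (y - ⟪y, v⟫ • v) = ⟪y, v⟫ from hy]
      abel
  refine (measure_mono hsub).trans_lt ((hψL.euclideanHausdorffMeasure_image_le k _).trans_lt ?_)
  refine ENNReal.mul_lt_top (ENNReal.pow_lt_top ENNReal.coe_lt_top) ?_
  rw [← finrank_orthogonal_span_singleton_eq hk hv,
    InnerProductSpace.euclideanHausdorffMeasure_eq_volume]
  exact measure_ball_lt_top

end Boundary

open scoped Pointwise in
/-- A measure which is homogeneous of degree `D` under dilations and log-concave with respect to
Minkowski combinations of sets. -/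
structure IsHomogeneousLogConcave {V : Type*} [AddCommGroup V] [Module ℝ V] [MeasurableSpace V]
    (μ : Measure V) (D : ℝ) : Prop where
  measure_smul : ∀ ⦃c : ℝ⦄, 0 < c → ∀ ⦃A : Set V⦄, MeasurableSet A →
    μ (c • A) = ENNReal.ofReal (c ^ D) * μ A
  logConcave : ∀ ⦃s t : ℝ⦄, 0 < s → 0 < t → s + t = 1 → ∀ ⦃A B C : Set V⦄, MeasurableSet A →
    MeasurableSet B → MeasurableSet C → (∀ x ∈ A, ∀ y ∈ B, s • x + t • y ∈ C) →
    μ A ^ s * μ B ^ t ≤ μ C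

section LogConcave

variable {V : Type*} [NormedAddCommGroup V] [InnerProductSpace ℝ V] [MeasurableSpace V]
  [BorelSpace V] [FiniteDimensional ℝ V]

open scoped Pointwise in
theorem measure_smul_of_homogeneous {f : V → ℝ≥0∞} (hf : Measurable f)
    {α : ℝ} (hom : ∀ t : ℝ, 0 < t → ∀ x, f (t • x) = ENNReal.ofReal (t ^ α) * f x)
    {c : ℝ} (hc : 0 < c) {A : Set V} (hA : MeasurableSet A) :
    ((volume : Measure V).withDensity f) (c • A) =
      ENNReal.ofReal (c ^ (Module.finrank ℝ V + α)) * (volume : Measure V).withDensity f A := by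
  have hcA : MeasurableSet (c • A) := hA.const_smul_of_ne_zero hc.ne'
  have hcn := pow_pos hc (Module.finrank ℝ V)
  rw [withDensity_apply _ hcA, withDensity_apply _ hA, ← lintegral_indicator hcA,
    ← lintegral_indicator hA]
  have h1 : ∫⁻ x, (c • A).indicator f (c • x) =
      ENNReal.ofReal (c ^ Module.finrank ℝ V)⁻¹ * ∫⁻ x, (c • A).indicator f x := by
    rw [← lintegral_map (hf.indicator hcA) (measurable_const_smul c),
      Measure.map_addHaar_smul volume hc.ne', lintegral_smul_measure, abs_of_pos (inv_pos.2 hcn),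
      smul_eq_mul]
  have h2 : ∀ x, (c • A).indicator f (c • x) = ENNReal.ofReal (c ^ α) * A.indicator f x := by
    intro x
    by_cases hx : x ∈ A
    · rw [indicator_of_mem (smul_mem_smul_set hx), indicator_of_mem hx, hom c hc]
    · rw [indicator_of_notMem ((smul_mem_smul_set_iff₀ hc.ne' _ _).not.2 hx),
        indicator_of_notMem hx, mul_zero]
  simp_rw [h2] at h1
  rw [lintegral_const_mul _ (hf.indicator hA)] at h1
  rw [Real.rpow_add hc, Real.rpow_natCast, ENNReal.ofReal_mul hcn.le, mul_assoc, h1, ← mul_assoc,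
    ← ENNReal.ofReal_mul hcn.le, mul_inv_cancel₀ hcn.ne', ENNReal.ofReal_one, one_mul]

theorem IsHomogeneousLogConcave.withDensity (hPL : PrekopaLeindler (volume : Measure V))
    {f : V → ℝ≥0∞} (hf : Measurable f) {α : ℝ}
    (hom : ∀ t : ℝ, 0 < t → ∀ x, f (t • x) = ENNReal.ofReal (t ^ α) * f x)
    (hlog : ∀ s t : ℝ, 0 < s → 0 < t → s + t = 1 → ∀ x y,
      f x ^ s * f y ^ t ≤ f (s • x + t • y)) :
    IsHomogeneousLogConcave ((volume : Measure V).withDensity f) (Module.finrank ℝ V + α) where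
  measure_smul _ hc _ hA := measure_smul_of_homogeneous hf hom hc hA
  logConcave s t hs ht hst A B C hA hB hC hABC := by
    rw [withDensity_apply _ hA, withDensity_apply _ hB, withDensity_apply _ hC,
      ← lintegral_indicator hA, ← lintegral_indicator hB, ← lintegral_indicator hC]
    refine hPL hs ht hst (hf.indicator hA) (hf.indicator hB) (hf.indicator hC) fun x y => ?_
    by_cases hx : x ∈ A
    · by_cases hy : y ∈ B
      · rw [indicator_of_mem hx, indicator_of_mem hy, indicator_of_mem (hABC x hx y hy)]
        exact hlog s t hs ht hst x y
      · simp [hy, ht]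
    · simp [hx, hs]

theorem lintegral_measure_ball_swap (μ ν : Measure V) [SFinite μ] [SFinite ν] (R : ℝ) :
    ∫⁻ z, ν (ball z R) ∂μ = ∫⁻ y, μ (ball y R) ∂ν := by
  have hm : MeasurableSet {p : V × V | dist p.2 p.1 < R} :=
    measurableSet_lt (by fun_prop) measurable_const
  have h1 := Measure.prod_apply (μ := μ) (ν := ν) hm
  rw [Measure.prod_apply_symm hm] at h1
  refine h1.symm.trans (lintegral_congr fun y => ?_)
  congr 1
  ext x
  simp [mem_ball, dist_comm]

theorem measurable_measure_ball (ν : Measure V) [SFinite ν] (R : ℝ) :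
    Measurable fun z => ν (ball z R) :=
  measurable_measure_prodMk_left (ν := ν) (s := {p : V × V | dist p.2 p.1 < R})
    (measurableSet_lt (by fun_prop) measurable_const)

end LogConcave

section BrunnMinkowski

variable {V : Type*} [NormedAddCommGroup V] [InnerProductSpace ℝ V] [MeasurableSpace V]
  [BorelSpace V]

open scoped Pointwise in
/-- Brunn–Minkowski inequality with a ball, linearized by Bernoulli's inequality. -/
theorem IsHomogeneousLogConcave.measure_add_le {μ : Measure V} {D : ℝ}
    (h : IsHomogeneousLogConcave μ D) (hD : 1 ≤ D) (hβ0 : μ (ball 0 1) ≠ 0)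
    (hβ : μ (ball 0 1) ≠ ∞) {A C : Set V} (hA : MeasurableSet A) (hC : MeasurableSet C) {ε : ℝ}
    (hε : 0 < ε) (hAC : ∀ x ∈ A, ∀ b ∈ ball (0 : V) ε, x + b ∈ C) (hA0 : μ A ≠ 0) :
    μ A + ENNReal.ofReal (ε * D) * (μ (ball 0 1) ^ (1 / D) * μ A ^ ((D - 1) / D)) ≤ μ C := by
  have hD0 : 0 < D := by linarith
  by_cases hAt : μ A = ∞
  · have : A ⊆ C := fun x hx => by simpa using hAC x hx 0 (mem_ball_self hε)
    rw [top_unique (hAt ▸ measure_mono this : ∞ ≤ μ C)]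
    exact le_top
  obtain ⟨x, hx, hx'⟩ : ∃ x : ℝ, 0 < x ∧ μ A = ENNReal.ofReal x :=
    ⟨_, ENNReal.toReal_pos hA0 hAt, (ENNReal.ofReal_toReal hAt).symm⟩
  obtain ⟨y, hy, hy'⟩ : ∃ y : ℝ, 0 < y ∧ μ (ball 0 1) = ENNReal.ofReal y :=
    ⟨_, ENNReal.toReal_pos hβ0 hβ, (ENNReal.ofReal_toReal hβ).symm⟩
  set a := x ^ (1 / D) with ha
  set b := y ^ (1 / D) with hb
  have ha0 : 0 < a := Real.rpow_pos_of_pos hx _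
  have hb0 : 0 < b := Real.rpow_pos_of_pos hy _
  have haD : a ^ D = x := by
    rw [ha, ← Real.rpow_mul hx.le, one_div_mul_cancel hD0.ne', Real.rpow_one]
  have hbD : b ^ D = y := by
    rw [hb, ← Real.rpow_mul hy.le, one_div_mul_cancel hD0.ne', Real.rpow_one]
  set N := a + ε * b with hN
  have hN0 : 0 < N := by positivity
  have hst : a / N + ε * b / N = 1 := by rw [← add_div, div_self hN0.ne']
  have key : ENNReal.ofReal (N ^ D) ≤ μ C := by
    have h1 : μ ((N / a) • A) = ENNReal.ofReal (N ^ D) := by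
      rw [h.measure_smul (by positivity) hA, hx', ← ENNReal.ofReal_mul (by positivity),
        Real.div_rpow hN0.le ha0.le, haD, div_mul_cancel₀ _ hx.ne']
    have h2 : μ ((N / b) • ball (0 : V) 1) = ENNReal.ofReal (N ^ D) := by
      rw [h.measure_smul (by positivity) measurableSet_ball, hy',
        ← ENNReal.ofReal_mul (by positivity), Real.div_rpow hN0.le hb0.le, hbD,
        div_mul_cancel₀ _ hy.ne']
    have h3 := h.logConcave (s := a / N) (t := ε * b / N) (by positivity) (by positivity) hst
      (hA.const_smul_of_ne_zero (show N / a ≠ 0 by positivity))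
      ((measurableSet_ball (x := (0 : V)) (ε := 1)).const_smul_of_ne_zero
        (show N / b ≠ 0 by positivity)) hC (by
          rintro _ ⟨p, hp, rfl⟩ _ ⟨q, hq, rfl⟩
          rw [smul_smul, smul_smul, show a / N * (N / a) = 1 by field_simp, one_smul,
            show ε * b / N * (N / b) = ε by field_simp]
          refine hAC p hp _ ?_
          rw [mem_ball_zero_iff] at hq ⊢
          rw [norm_smul, Real.norm_of_nonneg hε.le]
          exact mul_lt_of_lt_one_right hε hq)
    rwa [h1, h2, ← ENNReal.rpow_add_of_nonneg _ _ (by positivity) (by positivity), hst,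
      ENNReal.rpow_one] at h3
  refine le_trans ?_ key
  rw [hx', hy', ENNReal.ofReal_rpow_of_pos hx, ENNReal.ofReal_rpow_of_pos hy,
    ← ENNReal.ofReal_mul (by positivity), ← ENNReal.ofReal_mul (by positivity),
    ← ENNReal.ofReal_add (by positivity) (by positivity)]
  refine ENNReal.ofReal_le_ofReal ?_
  have hber := one_add_mul_self_le_rpow_one_add (s := ε * b / a)
    (by have : 0 ≤ ε * b / a := by positivity
        linarith) hD
  have hxa : x ^ ((D - 1) / D) = x / a := by
    rw [sub_div, div_self hD0.ne', Real.rpow_sub hx, Real.rpow_one]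
  calc x + ε * D * (b * x ^ ((D - 1) / D)) = x * (1 + D * (ε * b / a)) := by
        rw [hxa]; field_simp
    _ ≤ x * (1 + ε * b / a) ^ D := by gcongr
    _ = N ^ D := by
        rw [← haD, ← Real.mul_rpow ha0.le (by positivity)]
        congr 1
        rw [hN]; field_simp

/-- Integrated form of the Brunn–Minkowski inequality: if every superlevel set of `f` below height
one, fattened by `ε`, lies in the corresponding superlevel set of `g`, then the integral of `g`
exceeds that of `f` by a definite amount. -/
theorem IsHomogeneousLogConcave.lintegral_add_le {μ : Measure V} {D : ℝ}
    (h : IsHomogeneousLogConcave μ D) (hD : 1 ≤ D) (hβ0 : μ (ball 0 1) ≠ 0)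
    (hβ : μ (ball 0 1) ≠ ∞) {f g : V → ℝ≥0∞} (hf : Measurable f) (hg : Measurable g)
    (hf1 : ∀ x, f x ≤ 1) {ε : ℝ} (hε : 0 < ε)
    (hfg : ∀ x, ∀ b ∈ ball (0 : V) ε, f x ≤ g (x + b)) {E : Set V} (hE : μ E ≠ 0)
    (hfE : ∀ x ∈ E, f x = 1) :
    (∫⁻ x, f x ∂μ) + ENNReal.ofReal (ε * D) * (μ (ball 0 1) ^ (1 / D) * μ E ^ ((D - 1) / D)) ≤
      ∫⁻ x, g x ∂μ := by
  have hD0 : 0 ≤ (D - 1) / D := div_nonneg (by linarith) (by linarith)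
  calc _ ≤ ∫⁻ x, min (g x) 1 ∂μ := ?_
    _ ≤ _ := lintegral_mono fun x => min_le_left _ _
  rw [lintegral_eq_lintegral_meas_lt_of_le_one μ hf hf1,
    lintegral_eq_lintegral_meas_lt_of_le_one μ (hg.min measurable_const) fun x => min_le_right _ _]
  set c := ENNReal.ofReal (ε * D) * (μ (ball 0 1) ^ (1 / D) * μ E ^ ((D - 1) / D)) with hc
  have hc' : c = ∫⁻ _ in Ioo (0 : ℝ) 1, c := by simp
  rw [hc', ← lintegral_add_right _ measurable_const]
  refine setLIntegral_mono' measurableSet_Ioo fun u hu => ?_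
  have hEA : E ⊆ {x | ENNReal.ofReal u < f x} := fun x hx => by
    simp only [mem_ofPred_eq, hfE x hx]
    exact ENNReal.ofReal_lt_one.2 hu.2
  have hmono := measure_mono (μ := μ) hEA
  refine le_trans ?_ (h.measure_add_le hD hβ0 hβ (hf measurableSet_Ioi)
    ((hg.min measurable_const) measurableSet_Ioi) hε (A := {x | ENNReal.ofReal u < f x})
    (C := {x | ENNReal.ofReal u < min (g x) 1}) (fun x hx b hb => ?_)
    fun h0 => hE (le_antisymm (h0 ▸ hmono) zero_le))
  · rw [hc]
    gcongr
  · exact lt_min ((show ENNReal.ofReal u < f x from hx).trans_le (hfg x b hb))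
      (ENNReal.ofReal_lt_one.2 hu.2)

end BrunnMinkowski

section Perimeter

variable {V : Type*} [NormedAddCommGroup V] [InnerProductSpace ℝ V] [MeasurableSpace V]
  [BorelSpace V] [FiniteDimensional ℝ V]

theorem IsHomogeneousLogConcave.mul_volume_ball_le_lintegral_frontier {k : ℕ}
    (hk : Module.finrank ℝ V = k + 1) {μ : Measure V} [IsLocallyFiniteMeasure μ] {D : ℝ}
    (h : IsHomogeneousLogConcave μ D) (hD : 1 ≤ D) (hβ0 : μ (ball 0 1) ≠ 0) {Ω : Set V}
    (hb : Bornology.IsBounded Ω) (hfr : μHE[k] (frontier Ω) ≠ ∞) {r ε : ℝ}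
    (hr : 0 < r) (hε : 0 < ε) (hE : μ {z | ball z r ⊆ Ω} ≠ 0) :
    ENNReal.ofReal D * (μ (ball 0 1) ^ (1 / D) * μ {z | ball z r ⊆ Ω} ^ ((D - 1) / D)) *
      volume (ball (0 : V) r) ≤ ∫⁻ y in frontier Ω, μ (ball y (r + ε)) ∂μHE[k] := by
  set X := μ (ball 0 1) ^ (1 / D) * μ {z | ball z r ⊆ Ω} ^ ((D - 1) / D) with hX
  set B := volume (ball (0 : V) r) with hB
  have hB0 : B ≠ 0 := (measure_ball_pos volume _ hr).ne'
  have hBt : B ≠ ∞ := measure_ball_lt_top.ne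
  have hBz : ∀ z : V, volume (ball z r) = B := fun z => Measure.addHaar_ball_center volume z r
  have hβ : μ (ball 0 1) ≠ ∞ := isBounded_ball.measure_lt_top.ne
  set ν := (volume : Measure V).restrict Ω with hν
  set σ := (μHE[k] : Measure V).restrict (frontier Ω) with hσ
  have : IsFiniteMeasure σ := ⟨by rw [hσ, Measure.restrict_apply_univ]; exact hfr.lt_top⟩
  set f : V → ℝ≥0∞ := fun z => B⁻¹ * ν (ball z r) with hf
  set g : V → ℝ≥0∞ := fun z => f z + ENNReal.ofReal ε * (B⁻¹ * σ (ball z (r + ε))) with hg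
  have hfm : Measurable f := (measurable_measure_ball ν r).const_mul _
  have hσm := (measurable_measure_ball σ (r + ε)).const_mul B⁻¹
  have hνle : ∀ z, ν (ball z r) ≤ B := fun z => (Measure.restrict_apply_le _ _).trans (hBz z).le
  have hf1 : ∀ z, f z ≤ 1 := fun z =>
    (mul_le_mul_right (hνle z) _).trans (ENNReal.inv_mul_cancel hB0 hBt).le
  have hfin : ∫⁻ z, f z ∂μ ≠ ∞ := by
    have h1 : ∀ z, f z ≤ (thickening r Ω).indicator 1 z := fun z => by
      by_cases hz : z ∈ thickening r Ω
      · simpa [hz] using hf1 z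
      · have : Disjoint (ball z r) Ω := by
          rw [disjoint_left]
          exact fun x hx hxΩ => hz (mem_thickening_iff.2 ⟨x, hxΩ, by rwa [dist_comm]⟩)
        simp [hf, hν, Measure.restrict_apply measurableSet_ball, this.inter_eq]
    refine ((lintegral_mono h1).trans_lt ?_).ne
    rw [lintegral_indicator_one isOpen_thickening.measurableSet]
    exact hb.thickening.measure_lt_top
  have key := h.lintegral_add_le hD hβ0 hβ hfm (hfm.add (hσm.const_mul (ENNReal.ofReal ε))) hf1 hε
    (fun x b hb => ?_) hE (fun z hz => ?_)
  · simp only [Pi.add_apply] at key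
    rw [lintegral_add_left hfm, lintegral_const_mul _ hσm,
      lintegral_const_mul _ (measurable_measure_ball σ (r + ε)), lintegral_measure_ball_swap,
      ENNReal.add_le_add_iff_left hfin, ENNReal.ofReal_mul hε.le, mul_assoc,
      ENNReal.mul_le_mul_iff_right (ENNReal.ofReal_pos.2 hε).ne' ENNReal.ofReal_ne_top,
      mul_comm B⁻¹, ← div_eq_mul_inv, ENNReal.le_div_iff_mul_le (Or.inl hB0) (Or.inl hBt)] at key
    exact key
  · have h2 := volume_inter_ball_sub_le hk (Ω := Ω) (mem_ball_zero_iff.1 hb) (x + b) r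
    rw [add_sub_cancel_right] at h2
    simp only [Pi.add_apply, hf, hν, hσ, Measure.restrict_apply measurableSet_ball]
    rw [mul_left_comm, ← mul_add, inter_comm _ Ω, inter_comm _ Ω, inter_comm _ (frontier Ω)]
    gcongr
  · simp only [hf, hν, Measure.restrict_apply measurableSet_ball, inter_eq_left.2 hz, hBz]
    exact ENNReal.inv_mul_cancel hB0 hBt

theorem withDensity_ball_le_of_forall_le {W : V → ℝ≥0} {y : V} {R : ℝ} {c : ℝ≥0∞}
    (hW : ∀ x ∈ ball y R, (W x : ℝ≥0∞) ≤ c) :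
    (volume : Measure V).withDensity (fun x => (W x : ℝ≥0∞)) (ball y R) ≤
      c * volume (ball (0 : V) R) := by
  rw [withDensity_apply _ measurableSet_ball, ← Measure.addHaar_ball_center volume y R,
    ← setLIntegral_const]
  exact setLIntegral_mono' measurableSet_ball hW

/-- Weighted isoperimetric lower bound for the perimeter, for a continuous weight whose associated
measure is homogeneous and log-concave. -/
theorem IsHomogeneousLogConcave.le_lintegral_frontier {k : ℕ}
    (hk : Module.finrank ℝ V = k + 1) {W : V → ℝ≥0} (hW : Continuous W) {D : ℝ}
    (h : IsHomogeneousLogConcave ((volume : Measure V).withDensity fun x => (W x : ℝ≥0∞)) D)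
    (hD : 1 ≤ D) (hβ0 : (volume : Measure V).withDensity (fun x => (W x : ℝ≥0∞)) (ball 0 1) ≠ 0)
    {Ω : Set V} (hΩ : IsOpen Ω) (hb : Bornology.IsBounded Ω) (hfr : μHE[k] (frontier Ω) ≠ ∞)
    (hm0 : (volume : Measure V).withDensity (fun x => (W x : ℝ≥0∞)) Ω ≠ 0) :
    ENNReal.ofReal D *
        ((volume : Measure V).withDensity (fun x => (W x : ℝ≥0∞)) (ball 0 1) ^ (1 / D) *
          (volume : Measure V).withDensity (fun x => (W x : ℝ≥0∞)) Ω ^ ((D - 1) / D)) ≤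
      ∫⁻ y in frontier Ω, W y ∂μHE[k] := by
  set μ := (volume : Measure V).withDensity fun x => (W x : ℝ≥0∞) with hμ
  have : IsLocallyFiniteMeasure μ := IsLocallyFiniteMeasure.withDensity_coe hW
  have hβ : μ (ball 0 1) ≠ ∞ := isBounded_ball.measure_lt_top.ne
  have hV0 : volume (ball (0 : V) 1) ≠ 0 := (measure_ball_pos volume _ one_pos).ne'
  have hVt : volume (ball (0 : V) 1) ≠ ∞ := measure_ball_lt_top.ne
  have hD0 : 0 ≤ (D - 1) / D := div_nonneg (by linarith) (by linarith)
  have hDβ : ENNReal.ofReal D ≠ ∞ ∧ μ (ball 0 1) ^ (1 / D) ≠ ∞ :=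
    ⟨ENNReal.ofReal_ne_top, ENNReal.rpow_ne_top_of_nonneg (by positivity) hβ⟩
  have hcpt : IsCompact (frontier Ω) :=
    Metric.isCompact_of_isClosed_isBounded isClosed_frontier
      (hb.closure.subset frontier_subset_closure)
  have step : ∀ η : ℝ≥0, 0 < η →
      ENNReal.ofReal D * (μ (ball 0 1) ^ (1 / D) * μ Ω ^ ((D - 1) / D)) ≤
      (∫⁻ y in frontier Ω, W y ∂μHE[k]) + η * μHE[k] (frontier Ω) := by
    intro η hη
    obtain ⟨δ, hδ, hδW⟩ : ∃ δ > 0, ∀ y ∈ frontier Ω, ∀ x ∈ ball y δ, W x ≤ W y + η := by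
      have := hcpt.uniformContinuousAt_of_continuousAt W (fun y _ => hW.continuousAt)
        (Metric.dist_mem_uniformity (show (0 : ℝ) < η from hη))
      obtain ⟨δ, hδ, hδW⟩ := Metric.mem_uniformity_dist.1 this
      refine ⟨δ, hδ, fun y hy x hx => ?_⟩
      have h1 : dist (W y) (W x) < η := hδW (by rwa [dist_comm]) hy
      rw [NNReal.dist_eq, abs_lt] at h1
      rw [← NNReal.coe_le_coe]
      push_cast
      linarith [h1.1]
    set J := (∫⁻ y in frontier Ω, W y ∂μHE[k]) + η * μHE[k] (frontier Ω) with hJ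
    have hJint : ∫⁻ y in frontier Ω, ((W y : ℝ≥0∞) + η) ∂μHE[k] = J := by
      rw [lintegral_add_right _ measurable_const, setLIntegral_const]
    have hr : ∀ r, 0 < r → r < δ → μ {z | ball z r ⊆ Ω} ≠ 0 →
        ENNReal.ofReal D * (μ (ball 0 1) ^ (1 / D) * μ {z | ball z r ⊆ Ω} ^ ((D - 1) / D)) ≤ J := by
      intro r hr hrδ hE
      set X := ENNReal.ofReal D *
        (μ (ball 0 1) ^ (1 / D) * μ {z | ball z r ⊆ Ω} ^ ((D - 1) / D)) with hX
      set v : ℝ → ℝ≥0∞ := fun ρ => ENNReal.ofReal (ρ ^ (k + 1)) * volume (ball (0 : V) 1) with hv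
      have hvol : ∀ ρ, 0 < ρ → volume (ball (0 : V) ρ) = v ρ := fun ρ hρ => by
        rw [Measure.addHaar_ball_of_pos _ _ hρ, hk]
      have hvr0 : v r ≠ 0 := hvol r hr ▸ (measure_ball_pos volume _ hr).ne'
      have hvrt : v r ≠ ∞ := hvol r hr ▸ measure_ball_lt_top.ne
      have hεle : ∀ ε, 0 < ε → ε < δ - r → X * v r ≤ J * v (r + ε) := by
        intro ε hε hεδ
        rw [← hvol r hr, ← hvol (r + ε) (by positivity), ← hJint,
          ← lintegral_mul_const' _ _ measure_ball_lt_top.ne]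
        refine (h.mul_volume_ball_le_lintegral_frontier hk hD hβ0 hb hfr hr hε hE).trans ?_
        refine setLIntegral_mono' isClosed_frontier.measurableSet fun y hy => ?_
        refine withDensity_ball_le_of_forall_le fun x hx => ?_
        exact_mod_cast hδW y hy x (ball_subset_ball (by linarith) hx)
      have hlim : Filter.Tendsto (fun ε => J * v (r + ε)) (nhdsWithin 0 (Ioi 0))
          (nhds (J * v r)) := by
        refine ENNReal.Tendsto.const_mul ?_ (Or.inl hvr0)
        refine ENNReal.Tendsto.mul_const ?_ (Or.inr hVt)
        have hc : Continuous fun ε : ℝ => ENNReal.ofReal ((r + ε) ^ (k + 1)) :=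
          ENNReal.continuous_ofReal.comp (by fun_prop)
        have := hc.tendsto 0
        rw [add_zero] at this
        exact this.mono_left nhdsWithin_le_nhds
      have := ge_of_tendsto hlim (Filter.eventually_of_mem
        (Ioo_mem_nhdsGT (show (0 : ℝ) < δ - r by linarith)) fun ε hε => hεle ε hε.1 hε.2)
      rwa [ENNReal.mul_le_mul_iff_left hvr0 hvrt] at this
    set r : ℕ → ℝ := fun j => 1 / ((j : ℝ) + 1) with hrdef
    have hr0 : ∀ j, 0 < r j := fun j => by positivity
    have hmono : Monotone fun j => {z | ball z (r j) ⊆ Ω} := fun i j hij z hz =>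
      (ball_subset_ball (one_div_le_one_div_of_le (by positivity) (by gcongr))).trans hz
    have hU : ⋃ j, {z | ball z (r j) ⊆ Ω} = Ω := by
      refine Subset.antisymm (iUnion_subset fun j z hz => hz (mem_ball_self (hr0 j))) fun z hz => ?_
      obtain ⟨ρ, hρ, hρΩ⟩ := Metric.isOpen_iff.1 hΩ z hz
      obtain ⟨j, hj⟩ := exists_nat_one_div_lt hρ
      exact mem_iUnion.2 ⟨j, (ball_subset_ball hj.le).trans hρΩ⟩
    have hlimE : Filter.Tendsto (fun j => μ {z | ball z (r j) ⊆ Ω}) Filter.atTop (nhds (μ Ω)) := by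
      have := tendsto_measure_iUnion_atTop (μ := μ) hmono
      rwa [hU] at this
    have hlim := ENNReal.Tendsto.const_mul (a := ENNReal.ofReal D) (ENNReal.Tendsto.const_mul
      (a := μ (ball 0 1) ^ (1 / D)) ((ENNReal.continuous_rpow_const (y := (D - 1) / D)).tendsto _
        |>.comp hlimE) (Or.inr hDβ.2)) (Or.inr hDβ.1)
    refine le_of_tendsto hlim ?_
    filter_upwards [hlimE.eventually_ne hm0,
      tendsto_one_div_add_atTop_nhds_zero_nat.eventually_lt_const hδ] with j hj1 hj2
    exact hr (r j) (hr0 j) hj2 hj1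
  have hlim : Filter.Tendsto (fun η : ℝ≥0 => (∫⁻ y in frontier Ω, W y ∂μHE[k]) +
      η * μHE[k] (frontier Ω)) (nhdsWithin 0 (Ioi 0))
      (nhds ((∫⁻ y in frontier Ω, W y ∂μHE[k]) + (0 : ℝ≥0) * μHE[k] (frontier Ω))) := by
    refine tendsto_const_nhds.add (ENNReal.Tendsto.mul_const ?_ (Or.inr hfr))
    exact (ENNReal.continuous_coe.tendsto 0).mono_left nhdsWithin_le_nhds
  rw [ENNReal.coe_zero, zero_mul, add_zero] at hlim
  exact ge_of_tendsto hlim (Filter.eventually_of_mem self_mem_nhdsWithin fun η hη => step η hη)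

end Perimeter

theorem IsLipschitzDomain.euclideanHausdorffMeasure_frontier_lt_top {k : ℕ}
    {Ω : Set (EuclideanSpace ℝ (Fin (k + 1)))} (hΩ : IsLipschitzDomain Ω) :
    μHE[k] (frontier Ω) < ∞ := by
  obtain ⟨hopen, -, hb, hloc⟩ := hΩ
  have hcpt : IsCompact (frontier Ω) :=
    Metric.isCompact_of_isClosed_isBounded isClosed_frontier
      (hb.closure.subset frontier_subset_closure)
  refine hcpt.measure_lt_top_of_nhdsWithin fun x hx => ?_
  obtain ⟨r, hr, v, hv, K, φ, hφ, h⟩ := hloc x hx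
  refine ⟨frontier Ω ∩ ball x r, inter_mem_nhdsWithin _ (ball_mem_nhds x hr), ?_⟩
  refine (measure_mono ?_).trans_lt
    (euclideanHausdorffMeasure_graph_inter_ball_lt_top (by simp) hv hφ x r)
  exact subset_inter (frontier_inter_ball_subset_of_epigraph hopen hφ.continuous h)
    inter_subset_right

/-- The monomial weight `∏ i, (x i)₊ ^ A i`. -/
def monomialWeight {n : ℕ} (A : Fin n → ℝ) (x : EuclideanSpace ℝ (Fin n)) : ℝ≥0 :=
  ∏ i, (x i).toNNReal ^ A i

section MonomialWeight

variable {n : ℕ} {A : Fin n → ℝ}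

theorem continuous_monomialWeight (hA : ∀ i, 0 ≤ A i) : Continuous (monomialWeight A) := by
  refine continuous_finsetProd _ fun i _ => ?_
  exact (NNReal.continuous_rpow_const (hA i)).comp (continuous_real_toNNReal.comp (by fun_prop))

theorem monomialWeight_smul (hA : ∀ i, 0 ≤ A i) {t : ℝ} (ht : 0 < t)
    (x : EuclideanSpace ℝ (Fin n)) :
    (monomialWeight A (t • x) : ℝ≥0∞) = ENNReal.ofReal (t ^ ∑ i, A i) * monomialWeight A x := by
  rw [ENNReal.ofReal, ← ENNReal.coe_mul, ENNReal.coe_inj, ← NNReal.coe_inj, NNReal.coe_mul,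
    Real.coe_toNNReal _ (by positivity), Real.rpow_sum_of_nonneg ht.le fun i _ => hA i]
  simp only [monomialWeight, NNReal.coe_prod, NNReal.coe_rpow, PiLp.smul_apply, smul_eq_mul,
    Real.toNNReal_mul ht.le, NNReal.coe_mul, Real.coe_toNNReal _ ht.le]
  rw [← Finset.prod_mul_distrib]
  exact Finset.prod_congr rfl fun i _ => Real.mul_rpow ht.le (NNReal.coe_nonneg _)

theorem Real.toNNReal_rpow_mul_toNNReal_rpow_le {s t : ℝ} (hs : 0 < s) (ht : 0 < t)
    (hst : s + t = 1) (a b : ℝ) :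
    a.toNNReal ^ s * b.toNNReal ^ t ≤ (s * a + t * b).toNNReal := by
  rcases le_or_gt a 0 with ha | ha
  · simp [Real.toNNReal_of_nonpos ha, hs.ne']
  rcases le_or_gt b 0 with hb | hb
  · simp [Real.toNNReal_of_nonpos hb, ht.ne']
  rw [← NNReal.coe_le_coe, Real.coe_toNNReal _ (by positivity), NNReal.coe_mul, NNReal.coe_rpow,
    NNReal.coe_rpow, Real.coe_toNNReal _ ha.le, Real.coe_toNNReal _ hb.le]
  exact Real.geom_mean_le_arith_mean2_weighted hs.le ht.le ha.le hb.le hst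

theorem monomialWeight_rpow_mul_rpow_le (hA : ∀ i, 0 ≤ A i) {s t : ℝ} (hs : 0 < s) (ht : 0 < t)
    (hst : s + t = 1) (x y : EuclideanSpace ℝ (Fin n)) :
    (monomialWeight A x : ℝ≥0∞) ^ s * (monomialWeight A y : ℝ≥0∞) ^ t ≤
      monomialWeight A (s • x + t • y) := by
  rw [← ENNReal.coe_rpow_of_nonneg _ hs.le, ← ENNReal.coe_rpow_of_nonneg _ ht.le,
    ← ENNReal.coe_mul, ENNReal.coe_le_coe]
  simp only [monomialWeight, ← NNReal.finsetProd_rpow, ← Finset.prod_mul_distrib]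
  refine Finset.prod_le_prod' fun i _ => ?_
  rw [← NNReal.rpow_mul, ← NNReal.rpow_mul, mul_comm (A i), mul_comm (A i), NNReal.rpow_mul,
    NNReal.rpow_mul, ← NNReal.mul_rpow]
  exact NNReal.rpow_le_rpow (Real.toNNReal_rpow_mul_toNNReal_rpow_le hs ht hst _ _) (hA i)

theorem isHomogeneousLogConcave_monomialWeight (hA : ∀ i, 0 ≤ A i) :
    IsHomogeneousLogConcave
      ((volume : Measure (EuclideanSpace ℝ (Fin n))).withDensity
        fun x => (monomialWeight A x : ℝ≥0∞)) (n + ∑ i, A i) := by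
  have h := IsHomogeneousLogConcave.withDensity (prekopaLeindler_euclideanSpace n)
    (continuous_monomialWeight hA).measurable.coe_nnreal_ennreal
    (fun t ht x => monomialWeight_smul hA ht x)
    (fun s t hs ht hst x y => monomialWeight_rpow_mul_rpow_le hA hs ht hst x y)
  rwa [finrank_euclideanSpace_fin] at h

/-- The convex cone on which a monomial weight is positive. -/
def monomialCone (A : Fin n → ℝ) : Set (EuclideanSpace ℝ (Fin n)) :=
  {x | ∀ i, 0 < A i → 0 < x i}

theorem isOpen_monomialCone : IsOpen (monomialCone A) := by
  simp only [monomialCone, ofPred_forall]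
  exact isOpen_iInter_of_finite fun i => isOpen_iInter_of_finite fun _ =>
    isOpen_lt continuous_const (by fun_prop)

theorem coe_monomialWeight (hA : ∀ i, 0 ≤ A i) {x : EuclideanSpace ℝ (Fin n)}
    (hx : x ∈ monomialCone A) : (monomialWeight A x : ℝ) = ∏ i, x i ^ A i := by
  simp only [monomialWeight, NNReal.coe_prod, NNReal.coe_rpow]
  refine Finset.prod_congr rfl fun i _ => ?_
  rcases (hA i).eq_or_lt with h | h
  · simp [← h]
  · rw [Real.coe_toNNReal _ (hx i h).le]

theorem monomialWeight_ne_zero_iff (hA : ∀ i, 0 ≤ A i) {x : EuclideanSpace ℝ (Fin n)} :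
    monomialWeight A x ≠ 0 ↔ x ∈ monomialCone A := by
  simp only [monomialWeight, monomialCone, Finset.prod_ne_zero_iff, Finset.mem_univ, true_imp_iff,
    mem_ofPred_eq]
  refine forall_congr' fun i => ?_
  rcases (hA i).eq_or_lt with h | h
  · simp [← h]
  · simp [NNReal.rpow_eq_zero_iff, h.ne', h]

theorem withDensity_monomialWeight_ne_zero (hA : ∀ i, 0 ≤ A i)
    {U : Set (EuclideanSpace ℝ (Fin n))} (hU : IsOpen U) (hne : (U ∩ monomialCone A).Nonempty) :
    (volume : Measure (EuclideanSpace ℝ (Fin n))).withDensity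
      (fun x => (monomialWeight A x : ℝ≥0∞)) U ≠ 0 := by
  rw [Ne, withDensity_apply_eq_zero
    (continuous_monomialWeight hA).measurable.coe_nnreal_ennreal]
  have : {x | (monomialWeight A x : ℝ≥0∞) ≠ 0} = monomialCone A := by
    ext x
    rw [mem_ofPred_eq, ENNReal.coe_ne_zero, monomialWeight_ne_zero_iff hA]
  rw [this, inter_comm]
  exact ((hU.inter isOpen_monomialCone).measure_pos volume hne).ne'

theorem setLIntegral_monomialCone_inter (hA : ∀ i, 0 ≤ A i)
    (ν : Measure (EuclideanSpace ℝ (Fin n))) {T : Set (EuclideanSpace ℝ (Fin n))}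
    (hT : MeasurableSet T) :
    ∫⁻ x in monomialCone A ∩ T, monomialWeight A x ∂ν = ∫⁻ x in T, monomialWeight A x ∂ν := by
  have hS : MeasurableSet (monomialCone A) := isOpen_monomialCone.measurableSet
  have h0 : ∫⁻ x in T \ monomialCone A, monomialWeight A x ∂ν = 0 := by
    refine (setLIntegral_congr_fun (hT.diff hS) fun x hx => ?_).trans lintegral_zero
    exact ENNReal.coe_eq_zero.2 (not_not.1 fun h => hx.2 ((monomialWeight_ne_zero_iff hA).1 h))
  rw [inter_comm, ← lintegral_inter_add_sdiff _ T hS, h0, add_zero]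

theorem setIntegral_prod_rpow_eq_toReal (hA : ∀ i, 0 ≤ A i)
    (ν : Measure (EuclideanSpace ℝ (Fin n))) {T : Set (EuclideanSpace ℝ (Fin n))}
    (hT : MeasurableSet T) (hTA : T ⊆ monomialCone A) :
    ∫ x in T, ∏ i, x i ^ A i ∂ν = (∫⁻ x in T, monomialWeight A x ∂ν).toReal := by
  rw [← setIntegral_congr_fun hT fun x hx => coe_monomialWeight hA (hTA hx),
    integral_eq_lintegral_of_nonneg_ae (.of_forall fun x => NNReal.coe_nonneg _)
      (continuous_monomialWeight hA).measurable.coe_nnreal_real.aestronglyMeasurable]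
  simp only [ENNReal.ofReal_coe_nnreal]

theorem nonempty_ball_inter_monomialCone : (ball 0 1 ∩ monomialCone A).Nonempty := by
  have hc : Continuous fun t : ℝ => WithLp.toLp 2 fun _ : Fin n => t := by fun_prop
  have h0 : (WithLp.toLp 2 fun _ : Fin n => (0 : ℝ)) ∈ ball (0 : EuclideanSpace ℝ (Fin n)) 1 := by
    rw [show (WithLp.toLp 2 fun _ : Fin n => (0 : ℝ)) = 0 from rfl]
    exact mem_ball_self one_pos
  obtain ⟨t, ht, htb⟩ := ((hc.tendsto 0).eventually (isOpen_ball.mem_nhds h0)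
    |>.filter_mono nhdsWithin_le_nhds |>.and self_mem_nhdsWithin : ∀ᶠ t in nhdsWithin 0 (Ioi 0),
      (WithLp.toLp 2 fun _ : Fin n => t) ∈ ball (0 : EuclideanSpace ℝ (Fin n)) 1 ∧
        t ∈ Ioi (0 : ℝ)).exists
  exact ⟨_, ht, fun i _ => htb⟩

end MonomialWeight

/-- **Isoperimetric inequality with monomial weights.**
For nonnegative exponents `A i`, the weight `w x = ∏ i, (x i)^(A i)` in the cone
`S = {x : x i > 0 whenever A i > 0}` satisfies, with `α = ∑ i, A i` and `D = n + α`,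
`P_S(Ω)/m(Ω)^{(D-1)/D} ≥ P_S(S ∩ B₁)/m(S ∩ B₁)^{(D-1)/D}` for every bounded
Lipschitz domain `Ω ⊆ S`. -/
theorem isoperimetric_inequality_monomial_weights
    (n : ℕ) (hn : 1 ≤ n)
    (A : Fin n → ℝ) (hA : ∀ i, 0 ≤ A i)
    (w : EuclideanSpace ℝ (Fin n) → ℝ)
    (hw : ∀ x, w x = ∏ i : Fin n, (x i) ^ (A i))
    (S : Set (EuclideanSpace ℝ (Fin n)))
    (hS : S = {x : EuclideanSpace ℝ (Fin n) | ∀ i, 0 < A i → 0 < x i})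
    (α : ℝ) (hα : α = ∑ i : Fin n, A i)
    (Ω : Set (EuclideanSpace ℝ (Fin n))) (hΩ : IsLipschitzDomain Ω) (hΩS : Ω ⊆ S) :
    (∫ x in S ∩ frontier (S ∩ ball (0 : EuclideanSpace ℝ (Fin n)) 1), w x
        ∂(μH[(n : ℝ) - 1])) /
      (∫ x in S ∩ ball (0 : EuclideanSpace ℝ (Fin n)) 1, w x) ^
        (((n : ℝ) + α - 1) / ((n : ℝ) + α)) ≤
    (∫ x in S ∩ frontier Ω, w x ∂(μH[(n : ℝ) - 1])) /
      (∫ x in Ω, w x) ^ (((n : ℝ) + α - 1) / ((n : ℝ) + α)) := by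
  subst hα
  obtain rfl : S = monomialCone A := hS
  obtain rfl : w = fun x => ∏ i, x i ^ A i := funext hw
  obtain ⟨k, rfl⟩ : ∃ k, n = k + 1 := ⟨n - 1, by omega⟩
  obtain ⟨hopen, hconn, hb, -⟩ := id hΩ
  have hk : ((k + 1 : ℕ) : ℝ) - 1 = (k : ℝ) := by push_cast; ring
  have hα0 : 0 ≤ ∑ i, A i := Finset.sum_nonneg fun i _ => hA i
  set D : ℝ := ((k + 1 : ℕ) : ℝ) + ∑ i, A i with hD
  have hD1 : 1 ≤ D := by
    rw [hD]; push_cast; linarith [k.cast_nonneg (α := ℝ)]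
  have hW := continuous_monomialWeight hA
  have hβ0 := withDensity_monomialWeight_ne_zero hA isOpen_ball nonempty_ball_inter_monomialCone
  have hm0 := withDensity_monomialWeight_ne_zero hA hopen
    (by rw [inter_eq_left.2 hΩS]; exact hconn.nonempty)
  have hfr := hΩ.euclideanHausdorffMeasure_frontier_lt_top
  have lower := (isHomogeneousLogConcave_monomialWeight hA).le_lintegral_frontier (k := k)
    (by simp) hW hD1 hβ0 hopen hb hfr.ne hm0
  have upper := lintegral_sphere_le_of_homogeneous (k := k) (by simp)
    hW.measurable.coe_nnreal_ennreal hα0 (fun t ht x => monomialWeight_smul hA ht x)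
  have hlf := IsLocallyFiniteMeasure.withDensity_coe
    (μ := (volume : Measure (EuclideanSpace ℝ (Fin (k + 1))))) hW
  have hβt := (isBounded_ball (x := (0 : EuclideanSpace ℝ (Fin (k + 1)))) (r := 1)).measure_lt_top
    (μ := volume.withDensity fun x => (monomialWeight A x : ℝ≥0∞)) |>.ne
  have hmt := hb.measure_lt_top
    (μ := volume.withDensity fun x => (monomialWeight A x : ℝ≥0∞)) |>.ne
  rw [withDensity_apply _ measurableSet_ball] at hβ0 hβt lower
  rw [withDensity_apply _ hopen.measurableSet] at hm0 hmt lower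
  have hcpt : IsCompact (frontier Ω) :=
    Metric.isCompact_of_isClosed_isBounded isClosed_frontier
      (hb.closure.subset frontier_subset_closure)
  have hpt : ∫⁻ y in frontier Ω, monomialWeight A y ∂μHE[k] ≠ ∞ := by
    obtain ⟨c, hc⟩ := (hcpt.image hW).bddAbove
    refine ((setLIntegral_mono' isClosed_frontier.measurableSet fun y hy =>
      ENNReal.coe_le_coe.2 (hc (mem_image_of_mem _ hy))).trans_lt ?_).ne
    rw [setLIntegral_const]
    exact ENNReal.mul_lt_top ENNReal.coe_lt_top hfr
  have hSm : MeasurableSet (monomialCone A) := isOpen_monomialCone.measurableSet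
  rw [show monomialCone A ∩ frontier (monomialCone A ∩ ball 0 1) = monomialCone A ∩ sphere 0 1 by
      rw [inter_comm, inter_comm _ (ball _ _), frontier_inter_open_inter isOpen_monomialCone,
        frontier_ball _ one_ne_zero, inter_comm],
    hk, setIntegral_prod_rpow_eq_toReal hA _ (hSm.inter isClosed_sphere.measurableSet)
      inter_subset_left,
    setIntegral_prod_rpow_eq_toReal hA _ (hSm.inter measurableSet_ball) inter_subset_left,
    setIntegral_prod_rpow_eq_toReal hA _ (hSm.inter isClosed_frontier.measurableSet)
      inter_subset_left,
    setIntegral_prod_rpow_eq_toReal hA _ hopen.measurableSet hΩS]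
  rw [setLIntegral_monomialCone_inter hA _ isClosed_sphere.measurableSet,
    setLIntegral_monomialCone_inter hA _ measurableSet_ball,
    setLIntegral_monomialCone_inter hA _ isClosed_frontier.measurableSet]
  set β := ∫⁻ x in ball 0 1, (monomialWeight A x : ℝ≥0∞) with hβdef
  set m := ∫⁻ x in Ω, (monomialWeight A x : ℝ≥0∞) with hmdef
  simp only [Measure.euclideanHausdorffMeasure_def, Measure.restrict_smul, lintegral_smul_measure]
    at lower upper hpt
  set κ := Measure.addHaarScalarFactor (volume : Measure (EuclideanSpace ℝ (Fin k))) μH[k]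
  have hκ : κ ≠ 0 := Measure.addHaarScalarFactor_volume_hausdorffMeasure_ne_zero k
  rw [ENNReal.smul_def, smul_eq_mul] at lower upper hpt
  set b := ∫⁻ y in sphere 0 1, (monomialWeight A y : ℝ≥0∞) ∂μH[k]
  set p := ∫⁻ y in frontier Ω, (monomialWeight A y : ℝ≥0∞) ∂μH[k]
  have lowerR := ENNReal.toReal_mono hpt lower
  have upperR := ENNReal.toReal_mono (ENNReal.mul_ne_top ENNReal.ofReal_ne_top hβt) upper
  have hD0 : 0 < D := by linarith
  rw [ENNReal.toReal_mul, ENNReal.toReal_mul, ENNReal.toReal_mul, ENNReal.toReal_ofReal hD0.le,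
    ← ENNReal.toReal_rpow, ← ENNReal.toReal_rpow, ENNReal.coe_toReal] at lowerR
  rw [ENNReal.toReal_mul, ENNReal.toReal_mul, ENNReal.toReal_ofReal (by positivity),
    ENNReal.coe_toReal, show (k : ℝ) + 1 + ∑ i, A i = D by rw [hD]; push_cast; ring] at upperR
  have hβR : 0 < β.toReal := ENNReal.toReal_pos hβ0 hβt
  have hmR : 0 < m.toReal := ENNReal.toReal_pos hm0 hmt
  have hκR : 0 < (κ : ℝ) := NNReal.coe_pos.2 (pos_iff_ne_zero.2 hκ)
  have hβsplit : β.toReal = β.toReal ^ (1 / D) * β.toReal ^ ((D - 1) / D) := by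
    rw [← Real.rpow_add hβR, ← add_div, add_sub_cancel, div_self hD0.ne', Real.rpow_one]
  have hβe : 0 < β.toReal ^ ((D - 1) / D) := by positivity
  have hme : 0 < m.toReal ^ ((D - 1) / D) := by positivity
  refine le_of_mul_le_mul_left ?_ hκR
  rw [← mul_div_assoc, ← mul_div_assoc]
  calc (κ : ℝ) * b.toReal / β.toReal ^ ((D - 1) / D) ≤ D * β.toReal ^ (1 / D) := by
        rw [div_le_iff₀ hβe, mul_assoc, ← hβsplit]
        exact upperR
    _ ≤ κ * p.toReal / m.toReal ^ ((D - 1) / D) := by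
        rw [le_div_iff₀ hme, mul_assoc]
        exact lowerR

end
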